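/- arXiv:2406.12506 — 4 statements merged into one kernel-verified Lean document; each statement's English description precedes it below -/
import Mathlib

section
/- Let A and B be nonempty subsets of a nontrivial finite group G of order n, and let m be the minimum dimension of a nontrivial complex irreducible representation of G. Then |AB| > n/(1 + n²/(m·|A|·|B|)), and this quantity is at least min{n/2, m·|A|·|B|/(2n)}. -/
open scoped Pointwise

/-- The minimum dimension of a nontrivial complex irreducible representation of `G`. -/
noncomputable def minDeg (G : Type) [Group G] : ℕ :=
  sInf {d : ℕ | ∃ V : FDRep ℂ G, CategoryTheory.Simple V ∧ V.character ≠ 1 ∧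
    d = Module.finrank ℂ V}

open CategoryTheory in
theorem FDRep.simple_of_isIrreducible {G : Type} [Group G] [Finite G] {V : Type}
    [AddCommGroup V] [Module ℂ V] [FiniteDimensional ℂ V] (ρ : Representation ℂ G V)
    [ρ.IsIrreducible] : Simple (FDRep.of ρ) := by
  classical
  have := Fintype.ofFinite G
  have hG : (Nat.card G : ℂ) ≠ 0 := Nat.cast_ne_zero.2 Nat.card_pos.ne'
  have := invertibleOfNonzero hG
  have h := Representation.char_orthonormal ρ ρ
  rw [if_pos ⟨Representation.Equiv.refl ρ⟩, inv_mul_eq_one₀ hG] at h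
  exact (FDRep.simple_iff_char_is_norm_one (FDRep.of ρ)).2 h.symm

theorem Representation.eq_one_of_character_eq_one {G V : Type} [Group G]
    [AddCommGroup V] [Module ℂ V] [FiniteDimensional ℂ V] (ρ : Representation ℂ G V)
    (h : ρ.character = 1) (g : G) : ρ g = 1 := by
  have h1 : Module.finrank ℂ V = 1 := by
    have := ρ.char_one
    rw [h, Pi.one_apply] at this
    exact_mod_cast this.symm
  obtain ⟨c, hc⟩ := LinearMap.existsUnique_eq_smul_id_of_finrank_eq_one h1 (ρ g) |>.exists
  have h2 : LinearMap.trace ℂ V (ρ g) = 1 := congrFun h g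
  rw [hc, map_smul, LinearMap.trace_id, h1] at h2
  rw [hc]
  simp only [Nat.cast_one, smul_eq_mul, mul_one] at h2
  rw [h2, one_smul]
  rfl

open CategoryTheory in
theorem exists_simple_finrank_le {G : Type} [Group G] [Finite G] (N : ℕ) :
    ∀ {V : Type} [AddCommGroup V] [Module ℂ V] [FiniteDimensional ℂ V] [Nontrivial V]
      (ρ : Representation ℂ G V), (∀ v, (∀ g, ρ g v = v) → v = 0) → Module.finrank ℂ V = N →
      ∃ W : FDRep ℂ G, Simple W ∧ W.character ≠ 1 ∧ Module.finrank ℂ W ≤ N := by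
  induction N using Nat.strong_induction_on with
  | _ N ih =>
  intro V _ _ _ _ ρ hinv hN
  by_cases hirr : ρ.IsIrreducible
  · refine ⟨FDRep.of ρ, FDRep.simple_of_isIrreducible ρ, fun h ↦ ?_, hN.le⟩
    obtain ⟨v, hv⟩ := exists_ne (0 : V)
    refine hv (hinv v fun g ↦ ?_)
    rw [ρ.eq_one_of_character_eq_one h g]
    rfl
  · obtain ⟨σ, hbot, htop⟩ : ∃ σ : Subrepresentation ρ, σ.toSubmodule ≠ ⊥ ∧ σ.toSubmodule ≠ ⊤ := by
      by_contra! hall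
      have : Nontrivial (Subrepresentation ρ) :=
        ⟨⊥, ⊤, fun h ↦ bot_ne_top (α := Submodule ℂ V)
          (congrArg Subrepresentation.toSubmodule h)⟩
      refine hirr ⟨fun σ ↦ ?_⟩
      by_cases h : σ.toSubmodule = ⊥
      · exact .inl (Subrepresentation.toSubmodule_injective h)
      · exact .inr (Subrepresentation.toSubmodule_injective (hall σ h))
    have hlt : Module.finrank ℂ σ.toSubmodule < N := hN ▸ Submodule.finrank_lt htop
    have : Nontrivial σ.toSubmodule := Submodule.nontrivial_iff_ne_bot.2 hbot
    obtain ⟨W, hW, hc, hle⟩ := ih _ hlt σ.toRepresentation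
      (fun v hv ↦ Subtype.ext (hinv v fun g ↦ congrArg Subtype.val (hv g))) rfl
    exact ⟨W, hW, hc, hle.trans hlt.le⟩

theorem minDeg_le_finrank {G V : Type} [Group G] [Finite G] [AddCommGroup V] [Module ℂ V]
    [FiniteDimensional ℂ V] [Nontrivial V] (ρ : Representation ℂ G V)
    (hinv : ∀ v, (∀ g, ρ g v = v) → v = 0) : minDeg G ≤ Module.finrank ℂ V := by
  obtain ⟨W, hW, hc, hle⟩ := exists_simple_finrank_le _ ρ hinv rfl
  exact (Nat.sInf_le (s := {d : ℕ | ∃ V : FDRep ℂ G, CategoryTheory.Simple V ∧ V.character ≠ 1 ∧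
    d = Module.finrank ℂ V}) ⟨W, hW, hc, rfl⟩).trans hle

/-- The right regular representation on functions. -/
def rightTranslation (G : Type) [Group G] : Representation ℂ G (G → ℂ) where
  toFun g := LinearMap.funLeft ℂ ℂ (· * g)
  map_one' := by ext; simp [LinearMap.funLeft_apply]
  map_mul' g h := by ext; simp [LinearMap.funLeft_apply, mul_assoc]

@[simp]
theorem rightTranslation_apply {G : Type} [Group G] (g : G) (v : G → ℂ) (x : G) :
    rightTranslation G g v x = v (x * g) := rfl

/-- A subrepresentation of the right regular representation, consisting of functions of zero sum,
has no nonzero invariants. -/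
theorem Subrepresentation.eq_zero_of_invariant {G : Type} [Group G] [Fintype G]
    (σ : Subrepresentation (rightTranslation G)) (hσ : ∀ v ∈ σ.toSubmodule, ∑ x, v x = 0)
    (v : σ.toSubmodule) (hv : ∀ g, σ.toRepresentation g v = v) : v = 0 := by
  have hconst (g : G) : v.1 g = v.1 1 := by
    have := congrFun (congrArg Subtype.val (hv g)) 1
    simpa [Subrepresentation.toRepresentation] using this
  have hsum := hσ v v.2
  rw [Finset.sum_congr rfl fun x _ ↦ hconst x, Finset.sum_const, nsmul_eq_mul] at hsum
  have h1 : v.1 1 = 0 := by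
    rcases mul_eq_zero.1 hsum with h | h
    · simp at h
    · exact h
  ext g
  rw [hconst, h1]
  rfl

theorem minDeg_le_finrank_subrepresentation {G : Type} [Group G] [Fintype G]
    (σ : Subrepresentation (rightTranslation G)) (hσ : ∀ v ∈ σ.toSubmodule, ∑ x, v x = 0)
    (hne : σ.toSubmodule ≠ ⊥) : minDeg G ≤ Module.finrank ℂ σ.toSubmodule :=
  have : Nontrivial σ.toSubmodule := Submodule.nontrivial_iff_ne_bot.2 hne
  minDeg_le_finrank σ.toRepresentation (σ.eq_zero_of_invariant hσ)

theorem minDeg_pos (G : Type) [Group G] [Finite G] [Nontrivial G] : 0 < minDeg G := by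
  classical
  have := Fintype.ofFinite G
  let σ : Subrepresentation (rightTranslation G) :=
    { toSubmodule := LinearMap.ker (∑ x : G, LinearMap.proj (R := ℂ) (φ := fun _ ↦ ℂ) x)
      apply_mem_toSubmodule g v hv := by
        simp only [LinearMap.mem_ker, LinearMap.sum_apply, LinearMap.proj_apply,
          rightTranslation_apply] at hv ⊢
        rw [← hv]
        exact Equiv.sum_comp (Equiv.mulRight g) v }
  have hσ : ∀ v ∈ σ.toSubmodule, ∑ x, v x = 0 := fun v hv ↦ by
    simpa [σ] using hv
  have : Nontrivial σ.toSubmodule := by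
    obtain ⟨g, hg⟩ := exists_ne (1 : G)
    refine Submodule.nontrivial_iff_ne_bot.2 ((Submodule.ne_bot_iff _).2
      ⟨Pi.single g 1 - Pi.single 1 1, by simp [σ], fun h ↦ ?_⟩)
    simpa [hg] using congrFun h g
  obtain ⟨W, hW, hc, -⟩ :=
    exists_simple_finrank_le _ σ.toRepresentation (σ.eq_zero_of_invariant hσ) rfl
  obtain ⟨V, hV, -, hd⟩ := Nat.sInf_mem
    (s := {d : ℕ | ∃ V : FDRep ℂ G, CategoryTheory.Simple V ∧ V.character ≠ 1 ∧
      d = Module.finrank ℂ V}) ⟨_, W, hW, hc, rfl⟩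
  have hnorm := (FDRep.simple_iff_char_is_norm_one V).1 hV
  change 0 < sInf _
  rw [hd]
  by_contra! h0
  have : Subsingleton V := Module.finrank_zero_iff.1 (Nat.le_zero.1 h0)
  have hchar (g : G) : V.character g = 0 := by
    rw [FDRep.character, Subsingleton.elim (V.ρ g) 0, map_zero]
  simp only [hchar, mul_zero, Finset.sum_const_zero] at hnorm
  exact Nat.cast_ne_zero.2 Nat.card_pos.ne' hnorm.symm

open Matrix ComplexOrder in
/-- Every eigenvalue of a right-invariant positive semidefinite kernel killing the constants has
multiplicity at least `minDeg G`, unless it is zero. -/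
theorem minDeg_mul_eigenvalue_le_trace {G : Type} [Group G] [Fintype G] [DecidableEq G]
    (H : Matrix G G ℂ) (hH : H.PosSemidef) (hinv : ∀ x y g, H (x * g) (y * g) = H x y)
    (hone : ∀ y, ∑ x, H x y = 0) (i : G) :
    (minDeg G : ℝ) * hH.1.eigenvalues i ≤ H.trace.re := by
  have htr : H.trace.re = ∑ j, hH.1.eigenvalues j := by
    rw [hH.1.trace_eq_sum_eigenvalues]
    simp
  rw [htr]
  set μ := hH.1.eigenvalues i with hμ
  rcases eq_or_ne μ 0 with h0 | h0
  · rw [h0, mul_zero]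
    exact Finset.sum_nonneg fun j _ ↦ hH.eigenvalues_nonneg j
  let σ : Subrepresentation (rightTranslation G) :=
    { toSubmodule := Module.End.eigenspace (toLin' H) (μ : ℂ)
      apply_mem_toSubmodule g v hv := by
        rw [Module.End.mem_eigenspace_iff] at hv ⊢
        ext x
        have := congrFun hv (x * g)
        simp only [toLin'_apply, mulVec, dotProduct, Pi.smul_apply,
          rightTranslation_apply] at this ⊢
        rw [← this, ← Equiv.sum_comp (Equiv.mulRight g) fun y ↦ H (x * g) y * v y]
        simp [hinv] }
  have hσ : ∀ v ∈ σ.toSubmodule, ∑ x, v x = 0 := fun v hv ↦ by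
    have hv' : toLin' H v = (μ : ℂ) • v := Module.End.mem_eigenspace_iff.1 hv
    have h1 : ∑ x, (toLin' H v) x = 0 := by
      simp only [toLin'_apply, mulVec, dotProduct]
      rw [Finset.sum_comm]
      simp [← Finset.sum_mul, hone]
    rw [hv'] at h1
    simp only [Pi.smul_apply, smul_eq_mul] at h1
    rw [← Finset.mul_sum] at h1
    exact (mul_eq_zero.1 h1).resolve_left (by exact_mod_cast h0)
  have hne : σ.toSubmodule ≠ ⊥ := by
    refine (Submodule.ne_bot_iff _).2 ⟨(hH.1.eigenvectorBasis i).ofLp, ?_, fun h ↦ ?_⟩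
    · refine Module.End.mem_eigenspace_iff.2 ?_
      rw [toLin'_apply, hH.1.mulVec_eigenvectorBasis]
      rfl
    · exact hH.1.eigenvectorBasis.orthonormal.ne_zero i (WithLp.ofLp_injective 2 h)
  have hmult := LinearMap.finrank_eigenspace_le (toLin' H) (μ : ℂ)
  rw [charpoly_toLin', ← Polynomial.count_roots, hH.1.roots_charpoly_eq_eigenvalues,
    Multiset.count_map] at hmult
  have hcard : minDeg G ≤ (Finset.univ.filter fun j ↦ hH.1.eigenvalues j = μ).card := by
    refine (minDeg_le_finrank_subrepresentation σ hσ hne).trans (hmult.trans_eq ?_)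
    rw [Finset.card_def, Finset.filter_val]
    congr 1
    refine Multiset.filter_congr fun j _ ↦ ?_
    simp [eq_comm]
  calc (minDeg G : ℝ) * μ
      ≤ (Finset.univ.filter fun j ↦ hH.1.eigenvalues j = μ).card * μ := by
        have := hH.eigenvalues_nonneg i
        gcongr
    _ = ∑ j with hH.1.eigenvalues j = μ, hH.1.eigenvalues j := by
        rw [Finset.sum_congr rfl fun j hj ↦ (Finset.mem_filter.1 hj).2]
        simp
    _ ≤ ∑ j, hH.1.eigenvalues j :=
        Finset.sum_le_sum_of_subset_of_nonneg (Finset.filter_subset _ _)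
          fun j _ _ ↦ hH.eigenvalues_nonneg j

open Matrix MatrixOrder ComplexOrder in
theorem Matrix.IsHermitian.re_dotProduct_mulVec_le {ι : Type} [Fintype ι] [DecidableEq ι]
    {H : Matrix ι ι ℂ} (hH : H.IsHermitian) {K : ℝ} (hK : ∀ i, hH.eigenvalues i ≤ K)
    (v : ι → ℂ) : (star v ⬝ᵥ (H *ᵥ v)).re ≤ K * (star v ⬝ᵥ v).re := by
  have hle : H ≤ algebraMap ℝ (Matrix ι ι ℂ) K := by
    refine le_algebraMap_of_spectrum_le (fun x hx ↦ ?_) hH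
    rw [hH.spectrum_real_eq_range_eigenvalues] at hx
    obtain ⟨i, rfl⟩ := hx
    exact hK i
  have h := (Complex.le_def.1 ((Matrix.le_iff.1 hle).dotProduct_mulVec_nonneg v)).1
  rw [Algebra.algebraMap_eq_smul_one, sub_mulVec, smul_mulVec, one_mulVec, dotProduct_sub,
    dotProduct_smul] at h
  simpa using h

open Matrix ComplexOrder in
/-- Convolution with a function of zero sum has small operator norm. -/
theorem minDeg_mul_sum_norm_sq_convolution_le {G : Type} [Group G] [Fintype G]
    (f v : G → ℂ) (hf : ∑ x, f x = 0) :
    (minDeg G : ℝ) * ∑ x, ‖∑ y, f (x * y⁻¹) * v y‖ ^ 2 ≤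
      Fintype.card G * (∑ x, ‖f x‖ ^ 2) * ∑ x, ‖v x‖ ^ 2 := by
  classical
  have hnorm (w : G → ℂ) : (star w ⬝ᵥ w).re = ∑ x, ‖w x‖ ^ 2 := by
    simp [dotProduct, Complex.sq_norm, Complex.normSq_apply]
  rcases (Nat.zero_le (minDeg G)).eq_or_lt with h0 | h0
  · rw [← h0, Nat.cast_zero, zero_mul]
    positivity
  have hm : (0 : ℝ) < minDeg G := by exact_mod_cast h0
  let M : Matrix G G ℂ := .of fun x y ↦ f (x * y⁻¹)
  have hH : (Mᴴ * M).PosSemidef := posSemidef_conjTranspose_mul_self M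
  have htrace : (Mᴴ * M).trace.re = Fintype.card G * ∑ x, ‖f x‖ ^ 2 := by
    have hdiag (x : G) : ((Mᴴ * M) x x).re = ∑ z, ‖f z‖ ^ 2 := by
      rw [← Equiv.sum_comp (Equiv.mulRight x⁻¹)]
      simp [mul_apply, M, Complex.sq_norm, Complex.normSq_apply]
    simp [trace, hdiag]
  have hev (i : G) : hH.1.eigenvalues i ≤
      Fintype.card G * (∑ x, ‖f x‖ ^ 2) / minDeg G := by
    rw [le_div_iff₀ hm, ← htrace, mul_comm]
    refine minDeg_mul_eigenvalue_le_trace _ hH (fun x y g ↦ ?_) (fun y ↦ ?_) i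
    · simp only [mul_apply, conjTranspose_apply, M, of_apply]
      rw [← Equiv.sum_comp (Equiv.mulRight g)]
      simp [mul_assoc]
    · simp only [mul_apply, conjTranspose_apply, M, of_apply]
      rw [Finset.sum_comm]
      refine Finset.sum_eq_zero fun z _ ↦ ?_
      rw [← Finset.sum_mul, ← star_sum]
      have : ∑ x, f (z * x⁻¹) = 0 := by
        rw [← hf]
        exact Equiv.sum_comp ((Equiv.inv G).trans (Equiv.mulLeft z)) f
      rw [this, star_zero, zero_mul]
  have h := hH.1.re_dotProduct_mulVec_le hev v
  rw [← mulVec_mulVec, dotProduct_mulVec, vecMul_conjTranspose, star_star, hnorm, hnorm,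
    div_mul_eq_mul_div, le_div_iff₀ hm, mul_comm] at h
  exact h

theorem sq_sum_le_ncard_mul_sum_sq {ι : Type} [Fintype ι] (C : Set ι) (r : ι → ℝ)
    (hr : ∀ x, x ∉ C → r x = 0) : (∑ x, r x) ^ 2 ≤ C.ncard * ∑ x, r x ^ 2 := by
  classical
  rw [Set.ncard_eq_toFinset_card' C, ← Finset.sum_subset (Finset.subset_univ C.toFinset)
    fun x _ hx ↦ hr x (by simpa using hx)]
  refine sq_sum_le_card_mul_sum_sq.trans ?_
  gcongr
  exact Finset.subset_univ _

/-- The number of representations `x = a * b` with `a ∈ A` and `b ∈ B`. -/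
noncomputable def mulRepr {G : Type} [Group G] [Fintype G] (A B : Set G) (x : G) : ℝ :=
  ∑ y, A.indicator 1 (x * y⁻¹) * B.indicator 1 y

theorem mulRepr_eq_zero {G : Type} [Group G] [Fintype G] (A B : Set G) {x : G}
    (hx : x ∉ A * B) : mulRepr A B x = 0 := by
  refine Finset.sum_eq_zero fun y _ ↦ ?_
  by_cases hy : y ∈ B
  · have : x * y⁻¹ ∉ A := fun h ↦ hx ⟨_, h, y, hy, by simp⟩
    simp [this]
  · simp [hy]

theorem sum_indicator_one_eq_ncard {ι : Type} [Fintype ι] (A : Set ι) :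
    ∑ x, A.indicator (1 : ι → ℝ) x = A.ncard := by
  classical
  rw [Set.ncard_eq_toFinset_card' A]
  simp only [Set.indicator_apply, Pi.one_apply, Finset.sum_boole]
  congr 2
  ext
  simp

theorem sum_mulRepr {G : Type} [Group G] [Fintype G] (A B : Set G) :
    ∑ x, mulRepr A B x = A.ncard * B.ncard := by
  simp only [mulRepr]
  rw [Finset.sum_comm, ← sum_indicator_one_eq_ncard A, ← sum_indicator_one_eq_ncard B,
    Finset.mul_sum]
  refine Finset.sum_congr rfl fun y _ ↦ ?_
  rw [← Finset.sum_mul]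
  congr 1
  exact Equiv.sum_comp (Equiv.mulRight y⁻¹) _

theorem minDeg_mul_variance_mulRepr_le {G : Type} [Group G] [Fintype G] (A B : Set G) :
    (minDeg G : ℝ) *
        (∑ x, mulRepr A B x ^ 2 - ((A.ncard : ℝ) * B.ncard) ^ 2 / Fintype.card G) ≤
      Fintype.card G * (A.ncard - (A.ncard : ℝ) ^ 2 / Fintype.card G) * B.ncard := by
  have hn : (Fintype.card G : ℝ) ≠ 0 := Nat.cast_ne_zero.2 Fintype.card_ne_zero
  have hvar (r : G → ℝ) (s t : ℝ) (hs : ∑ x, r x = s) (ht : ∑ x, r x ^ 2 = t) :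
      ∑ x, (r x - s / Fintype.card G) ^ 2 = t - s ^ 2 / Fintype.card G := by
    simp only [sub_sq, Finset.sum_add_distrib, Finset.sum_sub_distrib, ← Finset.sum_mul,
      ← Finset.mul_sum, hs, ht, Finset.sum_const, Finset.card_univ, nsmul_eq_mul]
    field_simp
    ring
  have hind (C : Set G) : ∑ x, C.indicator (1 : G → ℝ) x ^ 2 = C.ncard := by
    rw [← sum_indicator_one_eq_ncard C]
    exact Finset.sum_congr rfl fun x _ ↦ by by_cases h : x ∈ C <;> simp [h]
  have hconv (x : G) :
      ∑ y, (A.indicator 1 (x * y⁻¹) - (A.ncard : ℝ) / Fintype.card G) * B.indicator 1 y =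
        mulRepr A B x - (A.ncard : ℝ) * B.ncard / Fintype.card G := by
    simp only [sub_mul, Finset.sum_sub_distrib]
    rw [← Finset.mul_sum, sum_indicator_one_eq_ncard, div_mul_eq_mul_div]
    rfl
  have h := minDeg_mul_sum_norm_sq_convolution_le
    (fun x : G ↦ ((A.indicator 1 x - A.ncard / Fintype.card G : ℝ) : ℂ))
    (fun x ↦ ((B.indicator 1 x : ℝ) : ℂ)) (by
      rw [← Complex.ofReal_sum, Finset.sum_sub_distrib, sum_indicator_one_eq_ncard]
      simp [mul_div_cancel₀ _ hn])
  simp only [← Complex.ofReal_mul, ← Complex.ofReal_sum, Complex.norm_real, Real.norm_eq_abs,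
    sq_abs, hconv, hind] at h
  rwa [hvar _ _ _ (sum_indicator_one_eq_ncard A) (hind A), hvar _ _ _ (sum_mulRepr A B) rfl] at h

theorem stmt7 (G : Type) [Group G] [Finite G] [Nontrivial G]
    (A B : Set G) (hA : A.Nonempty) (hB : B.Nonempty)
    (n : ℕ) (hn : n = Nat.card G) (m : ℕ) (hm : m = minDeg G) :
    ((A * B).ncard : ℝ) >
      (n : ℝ) / (1 + (n : ℝ) ^ 2 / ((m : ℝ) * (A.ncard : ℝ) * (B.ncard : ℝ))) ∧
    (n : ℝ) / (1 + (n : ℝ) ^ 2 / ((m : ℝ) * (A.ncard : ℝ) * (B.ncard : ℝ))) ≥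
      min ((n : ℝ) / 2) ((m : ℝ) * (A.ncard : ℝ) * (B.ncard : ℝ) / (2 * (n : ℝ))) := by
  have := Fintype.ofFinite G
  have hn0 : (0 : ℝ) < n := by rw [hn]; exact_mod_cast Nat.card_pos
  have hm0 : (0 : ℝ) < m := by rw [hm]; exact_mod_cast minDeg_pos G
  have ha : (0 : ℝ) < A.ncard := by exact_mod_cast (Set.ncard_pos).2 hA
  have hb : (0 : ℝ) < B.ncard := by exact_mod_cast (Set.ncard_pos).2 hB
  have hc : (0 : ℝ) < (A * B).ncard := by exact_mod_cast (Set.ncard_pos).2 (hA.mul hB)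
  have hcs := sq_sum_le_ncard_mul_sum_sq (A * B) _ fun x ↦ mulRepr_eq_zero A B
  have hvar := minDeg_mul_variance_mulRepr_le A B
  rw [sum_mulRepr] at hcs
  rw [← Nat.card_eq_fintype_card, ← hn, ← hm] at hvar
  generalize (A.ncard : ℝ) = a at *
  generalize (B.ncard : ℝ) = b at *
  generalize ((A * B).ncard : ℝ) = c at *
  generalize ∑ x, mulRepr A B x ^ 2 = S at *
  generalize (n : ℝ) = n at *
  generalize (m : ℝ) = m at *
  have hq : 0 < m * a * b := by positivity
  have hform : n / (1 + n ^ 2 / (m * a * b)) = n * (m * a * b) / (m * a * b + n ^ 2) := by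
    field_simp
  rw [hform]
  refine ⟨?_, ?_⟩
  · have hlt : m * S < n * (a * b) + m * (a * b) ^ 2 / n := by
      have : 0 < a ^ 2 * b := by positivity
      have h1 : n * (a - a ^ 2 / n) * b = n * (a * b) - a ^ 2 * b := by field_simp
      rw [h1, mul_sub, ← mul_div_assoc] at hvar
      linarith
    have h2 : (a * b) * (m * a * b) < (a * b) * (c * (n + m * a * b / n)) :=
      calc (a * b) * (m * a * b) = m * (a * b) ^ 2 := by ring
        _ ≤ m * (c * S) := by gcongr
        _ = c * (m * S) := by ring
        _ < c * (n * (a * b) + m * (a * b) ^ 2 / n) := by gcongr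
        _ = (a * b) * (c * (n + m * a * b / n)) := by field_simp
    have h3 := lt_of_mul_lt_mul_left h2 (by positivity)
    rw [gt_iff_lt, div_lt_iff₀ (by positivity)]
    calc n * (m * a * b) < n * (c * (n + m * a * b / n)) := by gcongr
      _ = c * (m * a * b + n ^ 2) := by field_simp; ring
  · generalize m * a * b = q at *
    rcases le_total (n ^ 2) q with h | h
    · refine (min_le_left _ _).trans ?_
      rw [div_le_div_iff₀ two_pos (by positivity)]
      nlinarith
    · refine (min_le_right _ _).trans ?_
      rw [div_le_div_iff₀ (by positivity) (by positivity)]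
      nlinarith
end

section
/- Let G be a nontrivial finite group of order n, let m be the minimum dimension of a nontrivial complex irreducible representation of G, and let Y : G → ℝ≥0 be a probability distribution on G (i.e. Σ_{g∈G} Y(g) = 1). Let M be the G×G real matrix with entries M_{x,y} = Y(x⁻¹y), and let U : G → ℝ≥0 be the uniform distribution, U(g) = 1/n. Then for every row vector v ∈ ℝ^G whose coordinates sum to 0, ‖vM‖ ≤ √(n/m)·‖Y − U‖·‖v‖, where ‖·‖ denotes the Euclidean norm (for functions on G, ‖f‖ = √(Σ_{g∈G} |f(g)|²)). -/
open Module in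
/-- A finite-dimensional complex representation of a finite group without nonzero invariant
vectors has dimension at least `minDeg G`, and `minDeg G` is then positive. -/
theorem minDeg_pos_and_le_finrank {G : Type} [Group G] [Finite G] {V : Type}
    [AddCommGroup V] [Module ℂ V] [FiniteDimensional ℂ V] [Nontrivial V]
    (ρ : Representation ℂ G V) (hρ : ρ.invariants = ⊥) :
    0 < minDeg G ∧ minDeg G ≤ finrank ℂ V := by
  have := Fintype.ofFinite G
  have hinv : Invertible (Nat.card G : ℂ) :=
    invertibleOfNonzero (Nat.cast_ne_zero.mpr Nat.card_pos.ne')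
  induction hd : finrank ℂ V using Nat.strong_induction_on generalizing V with
  | _ d ih =>
  by_cases hirr : ρ.IsIrreducible
  · have hsimple : CategoryTheory.Simple (FDRep.of ρ) := by
      rw [FDRep.simple_iff_char_is_norm_one]
      have h := Representation.char_orthonormal ρ ρ
      rw [if_pos ⟨Representation.Equiv.refl ρ⟩, inv_mul_eq_iff_eq_mul₀ (Invertible.ne_zero _),
        mul_one] at h
      exact h
    have hchar : (FDRep.of ρ).character ≠ 1 := by
      intro h
      have h1 := FDRep.average_char_eq_finrank_invariants (FDRep.of ρ)
      have h2 : finrank ℂ (Representation.invariants (FDRep.of ρ).ρ) = 0 := by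
        change finrank ℂ ρ.invariants = 0
        rw [hρ, finrank_bot]
      rw [h, h2] at h1
      simp at h1
    have hmem : d ∈ {d : ℕ | ∃ V : FDRep ℂ G, CategoryTheory.Simple V ∧ V.character ≠ 1 ∧
        d = Module.finrank ℂ V} := ⟨FDRep.of ρ, hsimple, hchar, hd.symm⟩
    refine ⟨?_, Nat.sInf_le hmem⟩
    obtain ⟨W, hW, -, hdim⟩ := Nat.sInf_mem ⟨d, hmem⟩
    rw [minDeg, hdim, Nat.pos_iff_ne_zero]
    intro h0
    have h := (FDRep.simple_iff_char_is_norm_one W).mp hW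
    have hsub : Subsingleton W := finrank_zero_iff.mp h0
    have hz : ∀ g, W.character g = 0 := fun g => by
      rw [FDRep.character, Subsingleton.elim (W.ρ g) 0, map_zero]
    simp [hz, eq_comm, Fintype.card_ne_zero] at h
  · obtain ⟨σ, hbot, htop⟩ : ∃ σ : Subrepresentation ρ, σ ≠ ⊥ ∧ σ ≠ ⊤ := by
      by_contra! h
      have : Nontrivial (Subrepresentation ρ) := by
        refine ⟨⊥, ⊤, fun h => ?_⟩
        exact bot_ne_top (α := Submodule ℂ V) (congrArg Subrepresentation.toSubmodule h)
      exact hirr ⟨fun σ => or_iff_not_imp_left.mpr (h σ)⟩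
    have hbot' : σ.toSubmodule ≠ ⊥ := fun h => hbot (Subrepresentation.toSubmodule_injective h)
    have htop' : σ.toSubmodule ≠ ⊤ := fun h => htop (Subrepresentation.toSubmodule_injective h)
    have := Submodule.nontrivial_iff_ne_bot.mpr hbot'
    have hlt : finrank ℂ σ.toSubmodule < d := hd ▸ Submodule.finrank_lt htop'
    have hσ : σ.toRepresentation.invariants = ⊥ := by
      rw [eq_bot_iff]
      intro w hw
      have : (w : V) ∈ ρ.invariants := fun g => congrArg Subtype.val (hw g)
      rw [hρ, Submodule.mem_bot] at this
      exact Subtype.ext this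
    have := ih _ hlt σ.toRepresentation hσ rfl
    exact ⟨this.1, this.2.trans hlt.le⟩

/-- The left translation action of `G` on complex functions on `G`. -/
def leftTranslation (G : Type) [Group G] : Representation ℂ G (G → ℂ) where
  toFun g := LinearMap.funLeft ℂ ℂ (fun x => g⁻¹ * x)
  map_one' := by ext; simp [LinearMap.funLeft_apply]
  map_mul' g h := by
    refine LinearMap.ext fun f => funext fun x => ?_
    simp [LinearMap.funLeft_apply, mul_assoc]

namespace Matrix

open scoped ComplexOrder

variable {ι : Type*} [Fintype ι] [DecidableEq ι] {A : Matrix ι ι ℂ}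

theorem IsHermitian.finrank_eigenspace_le (hA : A.IsHermitian) (c : ℝ) :
    Module.finrank ℂ (Module.End.eigenspace A.mulVecLin (c : ℂ)) ≤
      (Finset.univ.filter fun i => hA.eigenvalues i = c).card := by
  set I := Finset.univ.filter fun i => hA.eigenvalues i = c
  set b := hA.eigenvectorBasis
  suffices h : Module.End.eigenspace A.mulVecLin (c : ℂ) ≤
      Submodule.span ℂ ((I.image fun i => WithLp.ofLp (b i) : Finset (ι → ℂ)) : Set (ι → ℂ)) from
    (Submodule.finrank_mono h).trans ((finrank_span_finset_le_card _).trans Finset.card_image_le)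
  intro w hw
  rw [Module.End.mem_eigenspace_iff, mulVecLin_apply] at hw
  have hzero : ∀ i, hA.eigenvalues i ≠ c → inner ℂ (b i) (WithLp.toLp 2 w) = 0 := by
    intro i hi
    have hsymm := (isSymmetric_toEuclideanLin_iff.mpr hA) (b i) (WithLp.toLp 2 w)
    have h1 : A.toEuclideanLin (b i) = (hA.eigenvalues i : ℂ) • b i := by
      rw [toLpLin_apply, hA.mulVec_eigenvectorBasis]
      ext; simp [b]
    have h2 : A.toEuclideanLin (WithLp.toLp 2 w) = (c : ℂ) • WithLp.toLp 2 w := by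
      rw [toLpLin_apply, hw]; rfl
    rw [h1, h2, inner_smul_left, inner_smul_right, Complex.conj_ofReal, ← sub_eq_zero,
      ← sub_mul] at hsymm
    refine (mul_eq_zero.mp hsymm).resolve_left ?_
    exact_mod_cast sub_ne_zero.mpr hi
  have hsum := congrArg WithLp.ofLp (b.sum_repr' (WithLp.toLp 2 w))
  rw [WithLp.ofLp_sum] at hsum
  change _ = w at hsum
  rw [← hsum]
  refine Submodule.sum_mem _ fun i _ => ?_
  by_cases hi : hA.eigenvalues i = c
  · refine Submodule.smul_mem _ _ (Submodule.subset_span ?_)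
    exact Finset.mem_coe.mpr (Finset.mem_image_of_mem _ (by simp [I, hi]))
  · rw [hzero i hi, zero_smul]
    exact Submodule.zero_mem _

theorem PosSemidef.mul_finrank_eigenspace_le_trace (hA : A.PosSemidef) {c : ℝ} (hc : 0 ≤ c) :
    c * Module.finrank ℂ (Module.End.eigenspace A.mulVecLin (c : ℂ)) ≤ A.trace.re := by
  have htr : A.trace.re = ∑ i, hA.1.eigenvalues i := by
    rw [hA.1.trace_eq_sum_eigenvalues, Complex.re_sum]
    rfl
  rw [htr]
  calc _ ≤ c * (Finset.univ.filter fun i => hA.1.eigenvalues i = c).card := by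
        gcongr; exact hA.1.finrank_eigenspace_le c
    _ = ∑ i with hA.1.eigenvalues i = c, hA.1.eigenvalues i := by
        rw [Finset.sum_congr rfl fun i hi => (Finset.mem_filter.mp hi).2, Finset.sum_const,
          nsmul_eq_mul, mul_comm]
    _ ≤ _ := Finset.sum_le_univ_sum_of_nonneg hA.eigenvalues_nonneg

theorem IsHermitian.re_inner_toEuclideanLin_le (hA : A.IsHermitian) {c : ℝ}
    (hc : ∀ i, hA.eigenvalues i ≤ c) (w : EuclideanSpace ℂ ι) :
    (inner ℂ w (A.toEuclideanLin w)).re ≤ c * ‖w‖ ^ 2 := by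
  set b := hA.eigenvectorBasis
  have hb : ∀ i, inner ℂ (b i) (A.toEuclideanLin w) = hA.eigenvalues i * inner ℂ (b i) w := by
    intro i
    have h1 : A.toEuclideanLin (b i) = (hA.eigenvalues i : ℂ) • b i := by
      rw [toLpLin_apply, hA.mulVec_eigenvectorBasis]
      ext; simp [b]
    rw [← (isSymmetric_toEuclideanLin_iff.mpr hA) (b i) w, h1, inner_smul_left,
      Complex.conj_ofReal]
  rw [← b.sum_inner_mul_inner, ← b.sum_sq_norm_inner_right, Complex.re_sum, Finset.mul_sum]
  refine Finset.sum_le_sum fun i _ => ?_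
  have : inner ℂ w (b i) * inner ℂ (b i) (A.toEuclideanLin w) =
      ((hA.eigenvalues i * ‖inner ℂ (b i) w‖ ^ 2 : ℝ) : ℂ) := by
    rw [hb, mul_left_comm, ← inner_conj_symm w (b i), Complex.conj_mul']
    push_cast; rfl
  rw [this, Complex.ofReal_re]
  exact mul_le_mul_of_nonneg_right (hc i) (sq_nonneg _)

end Matrix

open Matrix ComplexOrder in
/-- If the columns of a matrix `N` invariant under left translation sum to zero, then each
eigenvalue of `N * Nᴴ` is at most `‖N‖² / minDeg G`, with the Frobenius norm on the right. -/
theorem le_trace_div_minDeg {G : Type} [Group G] [Fintype G] (N : Matrix G G ℂ)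
    (hN : ∀ g x y, N (g * x) (g * y) = N x y) (hsum : ∀ y, ∑ x, N x y = 0)
    {c : ℝ} (hc : 0 ≤ c) {w : G → ℂ} (hw0 : w ≠ 0) (hw : (N * Nᴴ) *ᵥ w = (c : ℂ) • w) :
    c ≤ (N * Nᴴ).trace.re / minDeg G := by
  classical
  have hpos : (N * Nᴴ).PosSemidef := posSemidef_self_mul_conjTranspose N
  have htr := hpos.mul_finrank_eigenspace_le_trace hc
  rcases hc.eq_or_lt with rfl | hc'
  · rw [zero_mul] at htr
    positivity
  have hA : ∀ g x y, (N * Nᴴ) (g * x) (g * y) = (N * Nᴴ) x y := by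
    intro g x y
    simp only [mul_apply, conjTranspose_apply]
    rw [← Equiv.sum_comp (Equiv.mulLeft g)]
    simp [hN]
  let E : Subrepresentation (leftTranslation G) :=
    { toSubmodule := Module.End.eigenspace (N * Nᴴ).mulVecLin (c : ℂ)
      apply_mem_toSubmodule := by
        intro g f hf
        rw [Module.End.mem_eigenspace_iff, mulVecLin_apply] at hf ⊢
        ext x
        have h := congrFun hf (g⁻¹ * x)
        simp only [mulVec, dotProduct, Pi.smul_apply] at h ⊢
        rw [← Equiv.sum_comp (Equiv.mulLeft g)]
        refine Eq.trans (Finset.sum_congr rfl fun y _ => ?_) h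
        rw [← hA g (g⁻¹ * x) y]
        simp [leftTranslation, LinearMap.funLeft_apply] }
  have : Nontrivial E.toSubmodule := by
    refine Submodule.nontrivial_iff_ne_bot.mpr fun h => hw0 ?_
    have hmem : w ∈ E.toSubmodule := by
      change w ∈ Module.End.eigenspace _ _
      rwa [Module.End.mem_eigenspace_iff, mulVecLin_apply]
    rwa [h, Submodule.mem_bot] at hmem
  have hinv : E.toRepresentation.invariants = ⊥ := by
    rw [eq_bot_iff]
    rintro ⟨f, hf⟩ hfix
    have hconst : ∀ x, f x = f 1 := fun x => by
      have h := congrFun (congrArg Subtype.val (hfix x)) x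
      change f (x⁻¹ * x) = f x at h
      rw [← h, inv_mul_cancel]
    have hker : Nᴴ *ᵥ f = 0 := by
      ext y
      simp only [mulVec, dotProduct, conjTranspose_apply, hconst, ← Finset.sum_mul, ← star_sum,
        hsum, star_zero, zero_mul, Pi.zero_apply]
    have hfE : (N * Nᴴ) *ᵥ f = (c : ℂ) • f := by
      have h := Module.End.mem_eigenspace_iff.mp hf
      rwa [mulVecLin_apply] at h
    rw [← mulVec_mulVec, hker, mulVec_zero] at hfE
    have hf0 := (smul_eq_zero.mp hfE.symm).resolve_left (Complex.ofReal_ne_zero.mpr hc'.ne')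
    exact (Submodule.mem_bot ℂ).mpr (Subtype.ext hf0)
  obtain ⟨hm, hle⟩ := minDeg_pos_and_le_finrank E.toRepresentation hinv
  rw [le_div_iff₀ (by exact_mod_cast hm)]
  refine le_trans ?_ htr
  gcongr

open Matrix ComplexOrder in
theorem stmt8 (G : Type) [Group G] [Fintype G] [Nontrivial G]
    (n : ℕ) (hn : n = Nat.card G) (m : ℕ) (hm : m = minDeg G)
    (Y : G → ℝ) (hY0 : ∀ g : G, 0 ≤ Y g) (hY1 : ∑ g : G, Y g = 1)
    (M : Matrix G G ℝ) (hM : ∀ x y : G, M x y = Y (x⁻¹ * y))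
    (v : G → ℝ) (hv : ∑ g : G, v g = 0) :
    Real.sqrt (∑ x : G, (Matrix.vecMul v M x) ^ 2) ≤
      Real.sqrt ((n : ℝ) / (m : ℝ)) *
        Real.sqrt (∑ g : G, (Y g - 1 / (n : ℝ)) ^ 2) *
        Real.sqrt (∑ x : G, (v x) ^ 2) := by
  classical
  have hcard : (Fintype.card G : ℝ) = n := by rw [hn, Nat.card_eq_fintype_card]
  have hn0 : (n : ℝ) ≠ 0 := by rw [← hcard]; exact_mod_cast Fintype.card_ne_zero
  set S := ∑ g : G, (Y g - 1 / (n : ℝ)) ^ 2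
  set N : Matrix G G ℂ := of fun x y => ((Y (x⁻¹ * y) - 1 / n : ℝ) : ℂ)
  have hN : ∀ x y, N x y = ((Y (x⁻¹ * y) - 1 / n : ℝ) : ℂ) := fun _ _ => rfl
  have hinv : ∀ g x y, N (g * x) (g * y) = N x y := by
    intro g x y
    rw [hN, hN, _root_.mul_inv_rev, mul_assoc, inv_mul_cancel_left]
  have hsum : ∀ y, ∑ x, N x y = 0 := by
    intro y
    simp only [hN]
    have hreindex : ∑ x, (Y (x⁻¹ * y) - 1 / (n : ℝ)) = ∑ g, (Y g - 1 / (n : ℝ)) :=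
      ((Equiv.inv G).trans (Equiv.mulRight y)).sum_comp fun g => Y g - 1 / (n : ℝ)
    rw [← Complex.ofReal_sum, Complex.ofReal_eq_zero, hreindex,
      Finset.sum_sub_distrib, hY1, Finset.sum_const, nsmul_eq_mul, Finset.card_univ, hcard,
      mul_one_div_cancel hn0, sub_self]
  have htrace : (N * Nᴴ).trace.re = n * S := by
    simp only [trace, diag_apply, mul_apply, conjTranspose_apply, hN, Complex.star_def,
      Complex.conj_ofReal, ← Complex.ofReal_mul, ← Complex.ofReal_sum, Complex.ofReal_re]
    have hconst : (n : ℝ) * S = ∑ _x : G, S := by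
      rw [Finset.sum_const, nsmul_eq_mul, Finset.card_univ, hcard]
    rw [hconst]
    refine Finset.sum_congr rfl fun x _ => ?_
    simp only [← pow_two]
    exact Equiv.sum_comp (Equiv.mulLeft x⁻¹) fun g => (Y g - 1 / (n : ℝ)) ^ 2
  have hpos : (N * Nᴴ).PosSemidef := posSemidef_self_mul_conjTranspose N
  obtain ⟨i, hi⟩ := Finite.exists_max hpos.1.eigenvalues
  have hle : hpos.1.eigenvalues i ≤ n / m * S := by
    have h := le_trace_div_minDeg N hinv hsum (hpos.eigenvalues_nonneg i)
      (w := hpos.1.eigenvectorBasis i) ?_ (hpos.1.mulVec_eigenvectorBasis i)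
    · rwa [htrace, ← hm, mul_div_right_comm] at h
    · intro h
      exact hpos.1.eigenvectorBasis.orthonormal.ne_zero i (WithLp.ofLp_injective 2 h)
  set w : EuclideanSpace ℂ G := WithLp.toLp 2 fun x => (v x : ℂ)
  have hw : ‖w‖ ^ 2 = ∑ x, v x ^ 2 := by
    simp [w, EuclideanSpace.norm_sq_eq]
  have hNw : Nᴴ *ᵥ (fun x => (v x : ℂ)) = fun y => ((vecMul v M y : ℝ) : ℂ) := by
    ext y
    simp only [mulVec, vecMul, dotProduct, conjTranspose_apply, hN, hM, Complex.star_def,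
      Complex.conj_ofReal, ← Complex.ofReal_mul, ← Complex.ofReal_sum]
    congr 1
    simp only [sub_mul, Finset.sum_sub_distrib, ← Finset.mul_sum, hv, mul_zero, sub_zero]
    exact Finset.sum_congr rfl fun _ _ => mul_comm _ _
  have hinner : (inner ℂ w ((N * Nᴴ).toEuclideanLin w)).re = ∑ x, (vecMul v M x) ^ 2 := by
    have hstar : star (fun x => (v x : ℂ)) ᵥ* N = star (Nᴴ *ᵥ fun x => (v x : ℂ)) := by
      rw [star_mulVec, conjTranspose_conjTranspose]
    rw [EuclideanSpace.inner_eq_star_dotProduct, toLpLin_apply, dotProduct_comm]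
    change (star (fun x => (v x : ℂ)) ⬝ᵥ ((N * Nᴴ) *ᵥ fun x => (v x : ℂ))).re = _
    rw [← mulVec_mulVec, dotProduct_mulVec, hstar, hNw]
    simp [dotProduct, ← Complex.ofReal_mul, ← Complex.ofReal_sum, pow_two]
  have hquad := hpos.1.re_inner_toEuclideanLin_le hi w
  rw [hinner, hw] at hquad
  rw [← Real.sqrt_mul (by positivity), ← Real.sqrt_mul (by positivity)]
  exact Real.sqrt_le_sqrt (hquad.trans (by gcongr))
end

section
/- There exists a constant C > 0 such that for every n ≥ 2 and every prime power q with (n,q) ∉ {(2,2),(2,3)}, the following holds for G = PSL_n(𝔽_q): if A and B are normal subsets of G with |A|·|B| ≥ (C/q)·|G|², then every nonidentity element of G lies in AB. -/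
open scoped Pointwise

open scoped InnerProductSpace

namespace OrthRep

variable {G : Type*} [Group G] {V : Type*} [NormedAddCommGroup V] [InnerProductSpace ℝ V]

/-- A real representation acting by isometries. -/
def IsOrth (ρ : Representation ℝ G V) : Prop := ∀ g v w, ⟪ρ g v, ρ g w⟫_ℝ = ⟪v, w⟫_ℝ

/-- The vectors fixed by every `u a`. -/
def fixed {M : Type*} (ρ : Representation ℝ G V) (u : M → G) : Submodule ℝ V where
  carrier := {v | ∀ a, ρ (u a) v = v}
  add_mem' hv hw a := by rw [map_add, hv a, hw a]
  zero_mem' a := map_zero _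
  smul_mem' c v hv a := by rw [map_smul, hv a]

theorem mem_fixed {M : Type*} {ρ : Representation ℝ G V} {u : M → G} {v : V} :
    v ∈ fixed ρ u ↔ ∀ a, ρ (u a) v = v := Iff.rfl

/-- The average of the operators `ρ (u a)`. -/
noncomputable def avg {M : Type*} [Fintype M] (ρ : Representation ℝ G V) (u : M → G) : V →ₗ[ℝ] V :=
  (Fintype.card M : ℝ)⁻¹ • ∑ a, ρ (u a)

theorem avg_apply {M : Type*} [Fintype M] (ρ : Representation ℝ G V) (u : M → G) (v : V) :
    avg ρ u v = (Fintype.card M : ℝ)⁻¹ • ∑ a, ρ (u a) v := by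
  simp [avg]

theorem rho_mul_apply (ρ : Representation ℝ G V) (g h : G) (v : V) :
    ρ (g * h) v = ρ g (ρ h v) := by
  rw [map_mul]; rfl

theorem rho_inv_apply_self (ρ : Representation ℝ G V) (g : G) (v : V) :
    ρ g⁻¹ (ρ g v) = v := by
  rw [← rho_mul_apply]; simp

namespace IsOrth

theorem inner_left {ρ : Representation ℝ G V} (hρ : IsOrth ρ) (g : G) (v w : V) :
    ⟪ρ g v, w⟫_ℝ = ⟪v, ρ g⁻¹ w⟫_ℝ := by
  rw [← hρ g⁻¹, rho_inv_apply_self]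

theorem inner_right {ρ : Representation ℝ G V} (hρ : IsOrth ρ) (g : G) (v w : V) :
    ⟪v, ρ g w⟫_ℝ = ⟪ρ g⁻¹ v, w⟫_ℝ := by
  rw [← hρ g⁻¹, rho_inv_apply_self]

theorem norm_eq {ρ : Representation ℝ G V} (hρ : IsOrth ρ) (g : G) (v : V) :
    ‖ρ g v‖ = ‖v‖ := by
  rw [norm_eq_sqrt_real_inner, hρ, ← norm_eq_sqrt_real_inner]

end IsOrth

theorem trace_avg_eq_sum {M : Type*} [Fintype M] (ρ : Representation ℝ G V) (u : M → G) :
    LinearMap.trace ℝ V (avg ρ u) =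
      (Fintype.card M : ℝ)⁻¹ * ∑ a, LinearMap.trace ℝ V (ρ (u a)) := by
  simp [avg]

section Avg

theorem hom_zero {M : Type*} [AddCommGroup M] {u : M → G} (hu : ∀ a b, u (a + b) = u a * u b) :
    u 0 = 1 := by
  have := hu 0 0
  simpa using this

theorem hom_neg {M : Type*} [AddCommGroup M] {u : M → G} (hu : ∀ a b, u (a + b) = u a * u b)
    (a : M) : u (-a) = (u a)⁻¹ := by
  rw [eq_inv_iff_mul_eq_one, ← hu, neg_add_cancel, hom_zero hu]

variable {M : Type*} [AddCommGroup M] [Fintype M] {ρ : Representation ℝ G V} {u : M → G}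

theorem card_ne_zero' (M : Type*) [AddCommGroup M] [Fintype M] : (Fintype.card M : ℝ) ≠ 0 := by
  exact_mod_cast Fintype.card_ne_zero

theorem rho_avg (hu : ∀ a b, u (a + b) = u a * u b) (b : M) (v : V) :
    ρ (u b) (avg ρ u v) = avg ρ u v := by
  rw [avg_apply, map_smul, map_sum]
  congr 1
  exact Fintype.sum_equiv (Equiv.addLeft b) _ _ fun a => by
    rw [← rho_mul_apply, ← hu]; rfl

theorem avg_mem (hu : ∀ a b, u (a + b) = u a * u b) (v : V) : avg ρ u v ∈ fixed ρ u :=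
  fun b => rho_avg hu b v

theorem avg_of_fixed {v : V} (hv : v ∈ fixed ρ u) : avg ρ u v = v := by
  rw [avg_apply, Finset.sum_congr rfl fun a _ => hv a]
  simp [card_ne_zero' M, ← Nat.cast_smul_eq_nsmul ℝ, smul_smul]

theorem avg_avg (hu : ∀ a b, u (a + b) = u a * u b) (v : V) :
    avg ρ u (avg ρ u v) = avg ρ u v := avg_of_fixed (avg_mem hu v)

theorem avg_rho (hu : ∀ a b, u (a + b) = u a * u b) (b : M) (v : V) :
    avg ρ u (ρ (u b) v) = avg ρ u v := by
  rw [avg_apply, avg_apply]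
  congr 1
  exact Fintype.sum_equiv (Equiv.addRight b) _ _ fun a => by
    rw [← rho_mul_apply, ← hu]; rfl

theorem inner_avg (hρ : IsOrth ρ) (hu : ∀ a b, u (a + b) = u a * u b) (v w : V) :
    ⟪avg ρ u v, w⟫_ℝ = ⟪v, avg ρ u w⟫_ℝ := by
  rw [avg_apply, avg_apply, inner_smul_left, inner_smul_right, sum_inner, inner_sum]
  simp only [conj_trivial]
  congr 1
  exact Fintype.sum_equiv (Equiv.neg M) _ _ fun a => by
    rw [hρ.inner_left, Equiv.neg_apply, hom_neg hu]

theorem inner_avg_self (hρ : IsOrth ρ) (hu : ∀ a b, u (a + b) = u a * u b) (v : V) :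
    ⟪avg ρ u v, v⟫_ℝ = ‖avg ρ u v‖ ^ 2 := by
  rw [← avg_avg hu, inner_avg hρ hu, real_inner_self_eq_norm_sq, avg_avg hu]

theorem trace_avg [FiniteDimensional ℝ V] (hu : ∀ a b, u (a + b) = u a * u b) :
    LinearMap.trace ℝ V (avg ρ u) = Module.finrank ℝ (fixed ρ u) :=
  LinearMap.IsProj.trace ⟨avg_mem hu, fun _ hv => avg_of_fixed hv⟩

end Avg

theorem trace_conj_rep (ρ : Representation ℝ G V) (g : G) (T : V →ₗ[ℝ] V) :
    LinearMap.trace ℝ V (ρ g * T * ρ g⁻¹) = LinearMap.trace ℝ V T := by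
  rw [LinearMap.trace_mul_comm, ← mul_assoc, ← map_mul]
  simp

theorem trace_conj_elt (ρ : Representation ℝ G V) {g h : G} (hgh : IsConj g h) :
    LinearMap.trace ℝ V (ρ g) = LinearMap.trace ℝ V (ρ h) := by
  obtain ⟨c, rfl⟩ := isConj_iff.1 hgh
  rw [map_mul ρ, map_mul ρ, trace_conj_rep]

theorem abs_trace_le [FiniteDimensional ℝ V] {ρ : Representation ℝ G V} (hρ : IsOrth ρ) (g : G) :
    |LinearMap.trace ℝ V (ρ g)| ≤ Module.finrank ℝ V := by
  rw [LinearMap.trace_eq_sum_inner (ρ g) (stdOrthonormalBasis ℝ V)]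
  refine (Finset.abs_sum_le_sum_abs _ _).trans ?_
  refine (Finset.sum_le_card_nsmul _ _ 1 fun i _ => ?_).trans (by simp)
  refine (abs_real_inner_le_norm _ _).trans ?_
  simp [hρ.norm_eq]

section Sub

variable {ρ : Representation ℝ G V}

theorem IsOrth.sub (hρ : IsOrth ρ) {E : Submodule ℝ V} (hE : ∀ g, E ≤ E.comap (ρ g)) :
    IsOrth (ρ.subrepresentation E hE) := fun g v w => hρ g v w

theorem finrank_fixed_sub {M : Type*} (u : M → G)
    {E : Submodule ℝ V} (hE : ∀ g, E ≤ E.comap (ρ g)) :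
    Module.finrank ℝ (fixed (ρ.subrepresentation E hE) u) =
      Module.finrank ℝ (E ⊓ fixed ρ u : Submodule ℝ V) := by
  have : fixed (ρ.subrepresentation E hE) u = (fixed ρ u).comap E.subtype := by
    ext v
    simp only [mem_fixed, Submodule.mem_comap]
    exact forall_congr' fun a => Subtype.ext_iff
  rw [this, ← Submodule.map_comap_subtype, Submodule.finrank_map_subtype_eq]

theorem invariant_orthogonal (hρ : IsOrth ρ) {E : Submodule ℝ V} (hE : ∀ g, E ≤ E.comap (ρ g))
    (g : G) : Eᗮ ≤ Eᗮ.comap (ρ g) := by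
  intro v hv
  rw [Submodule.mem_comap, Submodule.mem_orthogonal]
  intro w hw
  rw [hρ.inner_right]
  exact (Submodule.mem_orthogonal _ _).1 hv _ (hE _ hw)

theorem invariant_fixed_id (g : G) : fixed ρ id ≤ (fixed ρ id).comap (ρ g) := by
  intro v hv
  have h : ρ g v = v := hv g
  rwa [Submodule.mem_comap, h]

end Sub

variable [FiniteDimensional ℝ V]

theorem trace_sq_nonneg {T : V →ₗ[ℝ] V} (hT : ∀ v w, ⟪T v, w⟫_ℝ = ⟪v, T w⟫_ℝ) :
    0 ≤ LinearMap.trace ℝ V (T * T) := by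
  rw [LinearMap.trace_eq_sum_inner _ (stdOrthonormalBasis ℝ V)]
  refine Finset.sum_nonneg fun i _ => ?_
  rw [Module.End.mul_apply, ← hT]
  exact real_inner_self_nonneg

end OrthRep

namespace SLTwo

open Matrix OrthRep

variable {F : Type*} [Field F]

/-- Upper unitriangular matrices. -/
def upper (a : F) : SpecialLinearGroup (Fin 2) F := ⟨!![1, a; 0, 1], by simp [det_fin_two]⟩

/-- Lower unitriangular matrices. -/
def lower (a : F) : SpecialLinearGroup (Fin 2) F := ⟨!![1, 0; a, 1], by simp [det_fin_two]⟩

/-- The Weyl element. -/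
def weyl : SpecialLinearGroup (Fin 2) F := ⟨!![0, -1; 1, 0], by simp [det_fin_two]⟩

/-- The diagonal torus. -/
def torus (b : Fˣ) : SpecialLinearGroup (Fin 2) F :=
  ⟨!![(b⁻¹ : Fˣ), 0; 0, (b : F)], by simp [det_fin_two]⟩

@[simp] theorem coe_upper (a : F) : (upper a : Matrix (Fin 2) (Fin 2) F) = !![1, a; 0, 1] := rfl

@[simp] theorem coe_lower (a : F) : (lower a : Matrix (Fin 2) (Fin 2) F) = !![1, 0; a, 1] := rfl

@[simp] theorem coe_weyl : ((weyl : SpecialLinearGroup (Fin 2) F) : Matrix (Fin 2) (Fin 2) F) =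
    !![0, -1; 1, 0] := rfl

@[simp] theorem coe_torus (b : Fˣ) :
    (torus b : Matrix (Fin 2) (Fin 2) F) = !![((b⁻¹ : Fˣ) : F), 0; 0, (b : F)] := rfl

theorem upper_add (a b : F) : upper (a + b) = upper a * upper b := by
  ext i j
  fin_cases i <;> fin_cases j <;> simp [add_comm]

theorem lower_add (a b : F) : lower (a + b) = lower a * lower b := by
  ext i j
  fin_cases i <;> fin_cases j <;> simp

theorem torus_mul (b c : Fˣ) : torus (b * c) = torus b * torus c := by
  ext i j
  fin_cases i <;> fin_cases j <;> simp [mul_comm]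

theorem torus_upper (b : Fˣ) (a : F) :
    torus b * upper a = upper ((b⁻¹ : Fˣ) * a * (b⁻¹ : Fˣ)) * torus b := by
  ext i j
  fin_cases i <;> fin_cases j <;> simp

theorem weyl_sq : (weyl : SpecialLinearGroup (Fin 2) F) * weyl = torus (-1) := by
  ext i j
  fin_cases i <;> fin_cases j <;> simp

theorem weyl_torus (b : Fˣ) : weyl * torus b = torus b⁻¹ * weyl := by
  ext i j
  fin_cases i <;> fin_cases j <;> simp

theorem weyl_upper (a : F) : weyl * upper a = lower (-a) * weyl := by
  ext i j
  fin_cases i <;> fin_cases j <;> simp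

theorem lower_eq (b : Fˣ) :
    lower (b : F) = upper ((b⁻¹ : Fˣ) : F) * torus b * weyl * upper ((b⁻¹ : Fˣ) : F) := by
  ext i j
  fin_cases i <;> fin_cases j <;> simp

theorem generators {p : SpecialLinearGroup (Fin 2) F → Prop} (hu : ∀ a, p (upper a))
    (hl : ∀ a, p (lower a)) (hm : ∀ x y, p x → p y → p (x * y)) (g) : p g := by
  refine Matrix.SL2.transvection_induction p (fun i j h c => ?_) hm g
  fin_cases i <;> fin_cases j
  · exact absurd rfl h
  · convert hu c using 1
    ext i j
    fin_cases i <;> fin_cases j <;> simp [SpecialLinearGroup.transvection, transvection]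
  · convert hl c using 1
    ext i j
    fin_cases i <;> fin_cases j <;> simp [SpecialLinearGroup.transvection, transvection]
  · exact absurd rfl h

section Rep

variable {W : Type*} [AddCommGroup W] [Module ℝ W]

/-- A vector fixed by the Borel subgroup generates a vector fixed by the Weyl element. -/
theorem weyl_fixed [Fintype F] (ρ : Representation ℝ (SpecialLinearGroup (Fin 2) F) W) {w : W}
    (hu : ∀ a, ρ (upper a) w = w) (ht : ∀ b, ρ (torus b) w = w) :
    ρ weyl (w + ∑ a, ρ (upper a * weyl) w) = w + ∑ a, ρ (upper a * weyl) w := by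
  classical
  have key (b : Fˣ) : ρ (weyl * (upper (b : F) * weyl)) w =
      ρ (upper (((-b)⁻¹ : Fˣ) : F) * weyl) w := by
    have h1 : weyl * (upper (b : F) * weyl) = lower ((-b : Fˣ) : F) * (weyl * weyl) := by
      rw [← mul_assoc, weyl_upper, mul_assoc, Units.val_neg]
    have h2 : (weyl * (upper (b : F) * weyl) : SpecialLinearGroup (Fin 2) F) =
        upper (((-b)⁻¹ : Fˣ) : F) * weyl * torus (-b)⁻¹ * upper (((-b)⁻¹ : Fˣ) : F) *
          torus (-1) := by
      rw [h1, lower_eq, weyl_sq, mul_assoc (upper _) (torus _) weyl, ← inv_inv (-b), ← weyl_torus,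
        inv_inv]
      simp only [mul_assoc]
    rw [h2]
    simp only [map_mul, Module.End.mul_apply, hu, ht]
  have h0 : ρ (weyl * (upper 0 * weyl)) w = w := by
    have : (upper 0 : SpecialLinearGroup (Fin 2) F) = 1 := hom_zero upper_add
    rw [this, one_mul, weyl_sq, ht]
  have h0' : ρ (upper 0 * weyl) w = ρ weyl w := by
    have : (upper 0 : SpecialLinearGroup (Fin 2) F) = 1 := hom_zero upper_add
    rw [this, one_mul]
  have split (f : F → W) : ∑ a, f a = f 0 + ∑ b : Fˣ, f b := by
    rw [Fintype.sum_eq_add_sum_subtype_ne f 0]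
    congr 1
    exact (Fintype.sum_equiv unitsEquivNeZero _ _ fun b => rfl).symm
  rw [map_add, map_sum]
  simp only [← Module.End.mul_apply, ← map_mul]
  rw [split, h0, split fun a => ρ (upper a * weyl) w, h0']
  simp only [key]
  have : ∑ b : Fˣ, ρ (upper (((-b)⁻¹ : Fˣ) : F) * weyl) w = ∑ b : Fˣ, ρ (upper (b : F) * weyl) w :=
    Fintype.sum_equiv ((Equiv.neg Fˣ).trans (Equiv.inv Fˣ)) _ _ fun b => rfl
  rw [this]
  abel

theorem upper_fixed [Fintype F] (ρ : Representation ℝ (SpecialLinearGroup (Fin 2) F) W) {w : W}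
    (hu : ∀ a, ρ (upper a) w = w) (b : F) :
    ρ (upper b) (w + ∑ a, ρ (upper a * weyl) w) = w + ∑ a, ρ (upper a * weyl) w := by
  rw [map_add, hu, map_sum]
  congr 1
  refine Fintype.sum_equiv (Equiv.addLeft b) _ _ fun a => ?_
  rw [← Module.End.mul_apply, ← map_mul, ← mul_assoc, ← upper_add]
  rfl

theorem lower_fixed (ρ : Representation ℝ (SpecialLinearGroup (Fin 2) F) W) {w : W}
    (hu : ∀ a, ρ (upper a) w = w) (hs : ρ weyl w = w) (a : F) : ρ (lower a) w = w := by
  have h : ρ (weyl * upper (-a)) w = ρ (lower a * weyl) w := by rw [weyl_upper, neg_neg]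
  rwa [map_mul, map_mul, Module.End.mul_apply, Module.End.mul_apply, hu, hs, eq_comm] at h

theorem fixed_of_upper_weyl (ρ : Representation ℝ (SpecialLinearGroup (Fin 2) F) W) {w : W}
    (hu : ∀ a, ρ (upper a) w = w) (hs : ρ weyl w = w) (g) : ρ g w = w := by
  refine generators (p := fun g => ρ g w = w) hu (lower_fixed ρ hu hs) (fun x y hx hy => ?_) g
  rw [map_mul, Module.End.mul_apply, hy, hx]

end Rep
end SLTwo

namespace SLTwo

open Matrix OrthRep

variable {F : Type*} [Field F]

theorem upper_weyl (a : F) : upper a * weyl = weyl * lower (-a) := by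
  ext i j
  fin_cases i <;> fin_cases j <;> simp

theorem sum_eq_zero_add_units [Fintype F] {W : Type*} [AddCommMonoid W] (f : F → W) :
    ∑ a, f a = f 0 + ∑ᶠ b : Fˣ, f b := by
  classical
  rw [Fintype.sum_eq_add_sum_subtype_ne f 0, finsum_eq_sum_of_fintype]
  congr 1
  exact (Fintype.sum_equiv unitsEquivNeZero _ _ fun b => rfl).symm

theorem torus_add (a b : Additive Fˣ) :
    torus (a + b).toMul = torus a.toMul * torus b.toMul := torus_mul _ _

variable {V : Type*} [NormedAddCommGroup V] [InnerProductSpace ℝ V]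
  {ρ : Representation ℝ (SpecialLinearGroup (Fin 2) F) V}

theorem torus_mem_fixed {v : V} (hv : v ∈ fixed ρ (upper : F → _)) (b : Fˣ) :
    ρ (torus b) v ∈ fixed ρ (upper : F → _) := by
  intro a
  have h : upper a * torus b = torus b * upper ((b : F) * a * b) := by
    rw [torus_upper]
    congr 2
    simp [mul_assoc]
  rw [← rho_mul_apply, h, rho_mul_apply, hv]

variable [Fintype F]

theorem inner_weyl_nonpos (hρ : IsOrth ρ) (hinv : ∀ v, (∀ g, ρ g v = v) → v = 0) {w : V}
    (hu : w ∈ fixed ρ (upper : F → _)) (ht : ∀ b, ρ (torus b) w = w) :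
    ⟪ρ weyl w, w⟫_ℝ ≤ 0 := by
  have hz := hinv _ (fixed_of_upper_weyl ρ (upper_fixed ρ hu) (weyl_fixed ρ hu ht))
  have h : ⟪w + ∑ a, ρ (upper a * weyl) w, w⟫_ℝ = 0 := by rw [hz, inner_zero_left]
  have h2 (a : F) : ⟪ρ (upper a * weyl) w, w⟫_ℝ = ⟪ρ weyl w, w⟫_ℝ := by
    rw [rho_mul_apply, hρ.inner_left, ← hom_neg upper_add, hu]
  rw [inner_add_left, sum_inner, Finset.sum_congr rfl fun a _ => h2 a] at h
  simp only [Finset.sum_const, Finset.card_univ, nsmul_eq_mul] at h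
  have := real_inner_self_nonneg (x := w)
  have hq : (0 : ℝ) < Fintype.card F := by exact_mod_cast Fintype.card_pos
  by_contra! hc
  nlinarith [mul_pos hq hc]

theorem norm_avg_weyl_le (hρ : IsOrth ρ) (hinv : ∀ v, (∀ g, ρ g v = v) → v = 0) {v : V}
    (hv : v ∈ fixed ρ (upper : F → _)) :
    (Fintype.card F : ℝ) * ‖avg ρ (upper : F → _) (ρ weyl v)‖ ^ 2 ≤ ‖v‖ ^ 2 := by
  classical
  have hq : (Fintype.card F : ℝ) ≠ 0 := by exact_mod_cast Fintype.card_ne_zero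
  rw [← inner_avg_self hρ upper_add, avg_apply, inner_smul_left, sum_inner]
  simp only [conj_trivial]
  rw [mul_inv_cancel_left₀ hq]
  have h1 (a : F) : ⟪ρ (upper a) (ρ weyl v), ρ weyl v⟫_ℝ = ⟪ρ (lower (-a)) v, v⟫_ℝ := by
    rw [← rho_mul_apply, upper_weyl, rho_mul_apply, hρ]
  have h2 (b : Fˣ) : ⟪ρ (lower (b : F)) v, v⟫_ℝ = ⟪ρ (torus b) (ρ weyl v), v⟫_ℝ := by
    rw [lower_eq, rho_mul_apply, hv, mul_assoc, rho_mul_apply, hρ.inner_left, ← hom_neg upper_add,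
      hv, rho_mul_apply]
  have hl : (lower 0 : SpecialLinearGroup (Fin 2) F) = 1 := hom_zero lower_add
  set t := avg ρ (fun a : Additive Fˣ => torus a.toMul) with ht
  have htw : t (ρ weyl v) = ρ weyl (t v) := by
    rw [ht, avg_apply, avg_apply, map_smul, map_sum]
    congr 1
    refine Fintype.sum_equiv (Equiv.neg _) _ _ fun a => ?_
    rw [← rho_mul_apply, ← rho_mul_apply, weyl_torus]
    simp
  have htv : t v ∈ fixed ρ (upper : F → _) := by
    rw [ht, avg_apply]
    exact Submodule.smul_mem _ _ (Submodule.sum_mem _ fun a _ => torus_mem_fixed hv _)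
  have htt (b : Fˣ) : ρ (torus b) (t v) = t v := rho_avg torus_add (Additive.ofMul b) v
  have h3 : ∑ b : Fˣ, ⟪ρ (torus b) (ρ weyl v), v⟫_ℝ =
      Fintype.card (Additive Fˣ) * ⟪ρ weyl (t v), t v⟫_ℝ := by
    rw [← htw, ← inner_avg hρ torus_add, avg_avg torus_add, avg_apply, inner_smul_left,
      sum_inner]
    simp only [conj_trivial]
    rw [mul_inv_cancel_left₀ (card_ne_zero' _)]
    exact Fintype.sum_equiv Additive.ofMul _ _ fun b => rfl
  calc ∑ a, ⟪ρ (upper a) (ρ weyl v), ρ weyl v⟫_ℝ = ∑ a : F, ⟪ρ (lower (-a)) v, v⟫_ℝ := by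
        simp only [h1]
    _ = ∑ a : F, ⟪ρ (lower a) v, v⟫_ℝ := Fintype.sum_equiv (Equiv.neg F) _ _ fun a => rfl
    _ = ‖v‖ ^ 2 + Fintype.card (Additive Fˣ) * ⟪ρ weyl (t v), t v⟫_ℝ := by
        rw [sum_eq_zero_add_units, finsum_eq_sum_of_fintype, hl]
        simp only [h2, h3, map_one, Module.End.one_apply, real_inner_self_eq_norm_sq]
    _ ≤ ‖v‖ ^ 2 := by
        have := inner_weyl_nonpos hρ hinv htv htt
        have h0 : (0 : ℝ) ≤ Fintype.card (Additive Fˣ) := by positivity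
        nlinarith [mul_nonneg h0 (neg_nonneg.2 this)]

end SLTwo

namespace SLTwo

open Matrix OrthRep

variable {F : Type*} [Field F] {V : Type*} [NormedAddCommGroup V]
  [InnerProductSpace ℝ V] {ρ : Representation ℝ (SpecialLinearGroup (Fin 2) F) V}

theorem conj_apply {G : Type*} [Group G] (ρ : Representation ℝ G V) (g : G) (T : V →ₗ[ℝ] V) :
    Representation.linHom ρ ρ g T = ρ g * T * ρ g⁻¹ := by
  rw [Representation.linHom_apply]; rfl

theorem conj_eq_iff {G : Type*} [Group G] (ρ : Representation ℝ G V) (g : G) (T : V →ₗ[ℝ] V) :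
    Representation.linHom ρ ρ g T = T ↔ ρ g * T = T * ρ g := by
  rw [conj_apply]
  constructor
  · intro h
    nth_rewrite 2 [← h]
    rw [mul_assoc _ (ρ g⁻¹), ← map_mul, inv_mul_cancel, map_one, mul_one]
  · intro h
    rw [h, mul_assoc, ← map_mul, mul_inv_cancel, map_one, mul_one]

theorem inner_conj (hρ : IsOrth ρ) {T : V →ₗ[ℝ] V} (hT : ∀ v w, ⟪T v, w⟫_ℝ = ⟪v, T w⟫_ℝ)
    (g) (v w : V) : ⟪Representation.linHom ρ ρ g T v, w⟫_ℝ =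
      ⟪v, Representation.linHom ρ ρ g T w⟫_ℝ := by
  rw [conj_apply]
  simp only [Module.End.mul_apply]
  rw [hρ.inner_left, hT, hρ.inner_right]

variable [Fintype F]

/-- The sum of the projections to the vectors fixed by the conjugates of the upper unitriangular
group. -/
noncomputable def flagOp (ρ : Representation ℝ (SpecialLinearGroup (Fin 2) F) V) : V →ₗ[ℝ] V :=
  avg ρ (upper : F → _) +
    ∑ a : F, Representation.linHom ρ ρ (upper a * weyl) (avg ρ (upper : F → _))

theorem upper_avg (a : F) : ρ (upper a) * avg ρ (upper : F → _) = avg ρ (upper : F → _) :=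
  LinearMap.ext fun v => rho_avg upper_add a v

theorem avg_upper (a : F) : avg ρ (upper : F → _) * ρ (upper a) = avg ρ (upper : F → _) :=
  LinearMap.ext fun v => avg_rho upper_add a v

theorem torus_avg (b : Fˣ) : ρ (torus b) * avg ρ (upper : F → _) =
    avg ρ (upper : F → _) * ρ (torus b) := by
  ext v
  rw [Module.End.mul_apply, Module.End.mul_apply, avg_apply, avg_apply, map_smul, map_sum]
  congr 1
  refine Fintype.sum_equiv ((Units.mulLeft b⁻¹).trans (Units.mulRight b⁻¹)) _ _ fun a => ?_
  rw [← rho_mul_apply, torus_upper, rho_mul_apply]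
  rfl

theorem flagOp_weyl : ρ weyl * flagOp ρ = flagOp ρ * ρ weyl := by
  rw [← conj_eq_iff]
  refine weyl_fixed _ (fun a => ?_) (fun b => ?_)
  · rw [conj_eq_iff, upper_avg, avg_upper]
  · rw [conj_eq_iff, torus_avg]

theorem flagOp_upper (a : F) : ρ (upper a) * flagOp ρ = flagOp ρ * ρ (upper a) := by
  rw [← conj_eq_iff]
  refine upper_fixed _ (fun a => ?_) a
  rw [conj_eq_iff, upper_avg, avg_upper]

theorem inner_flagOp (hρ : IsOrth ρ) (v w : V) : ⟪flagOp ρ v, w⟫_ℝ = ⟪v, flagOp ρ w⟫_ℝ := by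
  simp only [flagOp, LinearMap.add_apply, LinearMap.sum_apply, inner_add_left, inner_add_right,
    sum_inner, inner_sum, inner_avg hρ (upper_add (F := F)),
    inner_conj hρ (inner_avg hρ (upper_add (F := F)))]

theorem trace_flagOp_sq : LinearMap.trace ℝ V (flagOp ρ * flagOp ρ) =
    (Fintype.card F + 1) * LinearMap.trace ℝ V (flagOp ρ * avg ρ (upper : F → _)) := by
  have h (a : F) : LinearMap.trace ℝ V
      (flagOp ρ * Representation.linHom ρ ρ (upper a * weyl) (avg ρ (upper : F → _))) =
      LinearMap.trace ℝ V (flagOp ρ * avg ρ (upper : F → _)) := by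
    have hc : ρ (upper a * weyl) * flagOp ρ = flagOp ρ * ρ (upper a * weyl) := by
      rw [map_mul, mul_assoc, flagOp_weyl, ← mul_assoc, flagOp_upper, mul_assoc]
    rw [conj_apply, ← mul_assoc, ← mul_assoc, ← hc, mul_assoc (ρ _), trace_conj_rep]
  conv_lhs => enter [2, 2]; rw [flagOp]
  rw [mul_add, Finset.mul_sum, map_add, map_sum]
  simp only [h]
  simp
  ring

variable [FiniteDimensional ℝ V]

theorem trace_flagOp : LinearMap.trace ℝ V (flagOp ρ) =
    (Fintype.card F + 1) * Module.finrank ℝ (fixed ρ (upper : F → _)) := by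
  rw [flagOp, map_add, map_sum]
  simp only [conj_apply, trace_conj_rep, trace_avg (upper_add (F := F))]
  simp
  ring

theorem trace_flagOp_avg (hρ : IsOrth ρ) (hinv : ∀ v, (∀ g, ρ g v = v) → v = 0) :
    LinearMap.trace ℝ V (flagOp ρ * avg ρ (upper : F → _)) ≤
      2 * Module.finrank ℝ (fixed ρ (upper : F → _)) := by
  set p := avg ρ (upper : F → _) with hp
  have hpp : p * p = p := LinearMap.ext fun v => avg_avg upper_add v
  have h (a : F) : LinearMap.trace ℝ V (Representation.linHom ρ ρ (upper a * weyl) p * p) =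
      LinearMap.trace ℝ V (p * ρ weyl⁻¹ * p * (p * ρ weyl * p)) := by
    have e1 : Representation.linHom ρ ρ (upper a * weyl) p * p =
        ρ (upper a) * (ρ weyl * p * (p * ρ weyl⁻¹ * (p * p))) := by
      have : ρ (upper a)⁻¹ * p = p := by rw [← hom_neg upper_add, hp, upper_avg]
      rw [conj_apply, _root_.mul_inv_rev, map_mul, map_mul]
      simp only [mul_assoc, this]
      rw [← mul_assoc p p, hpp]
    have e2 : ρ weyl * p * (p * ρ weyl⁻¹ * (p * p)) * ρ (upper a) =
        ρ weyl * p * (p * ρ weyl⁻¹ * (p * p)) := by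
      have : p * ρ (upper a) = p := by rw [hp, avg_upper]
      simp only [mul_assoc, this]
    rw [e1, LinearMap.trace_mul_comm, e2, LinearMap.trace_mul_comm]
    simp only [mul_assoc]
  have hb : LinearMap.trace ℝ V (p * ρ weyl⁻¹ * p * (p * ρ weyl * p)) ≤
      (Fintype.card F : ℝ)⁻¹ * LinearMap.trace ℝ V p := by
    rw [LinearMap.trace_eq_sum_inner _ (stdOrthonormalBasis ℝ V),
      LinearMap.trace_eq_sum_inner _ (stdOrthonormalBasis ℝ V), Finset.mul_sum]
    refine Finset.sum_le_sum fun i _ => ?_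
    set b := stdOrthonormalBasis ℝ V i
    have e1 : ⟪b, (p * ρ weyl⁻¹ * p * (p * ρ weyl * p)) b⟫_ℝ = ‖p (ρ weyl (p b))‖ ^ 2 := by
      simp only [Module.End.mul_apply]
      rw [← inner_avg hρ upper_add, hρ.inner_right, inv_inv, ← inner_avg hρ upper_add,
        ← hp, real_inner_self_eq_norm_sq]
    rw [e1, real_inner_comm, inner_avg_self hρ upper_add]
    have := norm_avg_weyl_le hρ hinv (avg_mem (ρ := ρ) upper_add b)
    rw [← hp] at this ⊢
    have hq : (0 : ℝ) < Fintype.card F := by exact_mod_cast Fintype.card_pos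
    rwa [← div_eq_inv_mul, le_div_iff₀' hq]
  rw [flagOp, add_mul, Finset.sum_mul, map_add, map_sum, ← hp, hpp]
  simp only [h]
  rw [← trace_avg upper_add, ← hp]
  have hq : (0 : ℝ) < Fintype.card F := by exact_mod_cast Fintype.card_pos
  rw [← div_eq_inv_mul, le_div_iff₀' hq] at hb
  simp
  linarith

theorem finrank_fixed_le_of_no_invariants (hρ : IsOrth ρ) (hinv : ∀ v, (∀ g, ρ g v = v) → v = 0) :
    ((Fintype.card F : ℝ) + 1) * Module.finrank ℝ (fixed ρ (upper : F → _)) ≤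
      2 * Module.finrank ℝ V := by
  have h1 := trace_sq_nonneg (T := (2 : ℝ) • 1 - flagOp ρ) fun v w => by
    simp [inner_sub_left, inner_sub_right, inner_flagOp hρ, inner_smul_left, inner_smul_right]
  have h2 : ((2 : ℝ) • 1 - flagOp ρ) * ((2 : ℝ) • 1 - flagOp ρ) =
      (4 : ℝ) • 1 - (4 : ℝ) • flagOp ρ + flagOp ρ * flagOp ρ := by
    simp only [sub_mul, mul_sub, smul_mul_assoc, mul_smul_comm, one_mul, mul_one]
    module
  rw [h2, map_add, map_sub, map_smul, map_smul, trace_flagOp, trace_flagOp_sq,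
    LinearMap.trace_one] at h1
  have h3 := trace_flagOp_avg hρ hinv
  have hq : (0 : ℝ) < Fintype.card F := by exact_mod_cast Fintype.card_pos
  simp only [smul_eq_mul] at h1
  nlinarith [mul_le_mul_of_nonneg_left h3 (by linarith : (0 : ℝ) ≤ Fintype.card F + 1)]

theorem finrank_fixed_le (hρ : IsOrth ρ) :
    ((Fintype.card F : ℝ) + 1) * Module.finrank ℝ (fixed ρ (upper : F → _)) ≤
      ((Fintype.card F : ℝ) + 1) * Module.finrank ℝ (fixed ρ id) + 2 * Module.finrank ℝ V := by
  set E := fixed ρ id with hE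
  have hi := invariant_orthogonal hρ (E := E) (invariant_fixed_id (ρ := ρ))
  have h := finrank_fixed_le_of_no_invariants (hρ.sub hi) (fun v hv => by
    have hv' : (v : V) ∈ E := fun g => congrArg Subtype.val (hv g)
    have := (Submodule.mem_orthogonal _ _).1 v.2 v hv'
    exact Subtype.ext (inner_self_eq_zero.1 this))
  rw [finrank_fixed_sub, ] at h
  have hle : E ≤ fixed ρ (upper : F → _) := fun v hv a => hv _
  have h1 := Submodule.finrank_add_inf_finrank_orthogonal hle
  have h2 : Module.finrank ℝ Eᗮ ≤ Module.finrank ℝ V := Submodule.finrank_le _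
  rw [← h1]
  push_cast
  have h3 : (Module.finrank ℝ Eᗮ : ℝ) ≤ Module.finrank ℝ V := by exact_mod_cast h2
  linarith

end SLTwo

namespace SLN

open Matrix OrthRep

variable {F : Type*} [Field F] {ι : Type*} [Fintype ι] [DecidableEq ι]

theorem sl_ext {A B : SpecialLinearGroup ι F} (h : (A : Matrix ι ι F) = (B : Matrix ι ι F)) :
    A = B := Subtype.ext h

/-- The transvection `1 + v ⊗ φ`. -/
def tv (v φ : ι → F) (h : φ ⬝ᵥ v = 0) : SpecialLinearGroup ι F :=
  ⟨1 + vecMulVec v φ, by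
    rw [vecMulVec_eq Unit, det_one_add_replicateCol_mul_replicateRow, h,
      add_zero]⟩

@[simp] theorem coe_tv (v φ : ι → F) (h : φ ⬝ᵥ v = 0) :
    (tv v φ h : Matrix ι ι F) = 1 + vecMulVec v φ := rfl

theorem tv_congr {v v' φ φ' : ι → F} (h : φ ⬝ᵥ v = 0) (hv : v = v') (hφ : φ = φ') :
    tv v φ h = tv v' φ' (hφ ▸ hv ▸ h) := by
  subst hv hφ; rfl

theorem tv_mul_left {v φ ψ : ι → F} (h : φ ⬝ᵥ v = 0) (h' : ψ ⬝ᵥ v = 0)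
    (h'' : (φ + ψ) ⬝ᵥ v = 0) : tv v (φ + ψ) h'' = tv v φ h * tv v ψ h' := by
  refine sl_ext ?_
  rw [Matrix.SpecialLinearGroup.coe_mul, coe_tv, coe_tv, coe_tv, mul_add,
    add_mul, add_mul,
    vecMulVec_mul_vecMulVec, h, vecMulVec_add]
  simp [add_assoc]

theorem tv_mul_right {v w φ : ι → F} (h : φ ⬝ᵥ v = 0) (h' : φ ⬝ᵥ w = 0)
    (h'' : φ ⬝ᵥ (v + w) = 0) : tv (v + w) φ h'' = tv v φ h * tv w φ h' := by
  refine sl_ext ?_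
  rw [Matrix.SpecialLinearGroup.coe_mul, coe_tv, coe_tv, coe_tv, mul_add,
    add_mul, add_mul,
    vecMulVec_mul_vecMulVec, h', add_vecMulVec]
  simp [add_assoc]

theorem mul_tv {g : SpecialLinearGroup ι F} {v φ v' φ' : ι → F} (h : φ ⬝ᵥ v = 0)
    (h' : φ' ⬝ᵥ v' = 0) (hv : (g : Matrix ι ι F) *ᵥ v = v') (hφ : φ' ᵥ* (g : Matrix ι ι F) = φ) :
    g * tv v φ h = tv v' φ' h' * g := by
  refine sl_ext ?_
  rw [Matrix.SpecialLinearGroup.coe_mul, Matrix.SpecialLinearGroup.coe_mul, coe_tv, coe_tv, mul_add,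
    add_mul,
    mul_vecMulVec, vecMulVec_mul, hv, hφ]
  simp

omit [DecidableEq ι] in
theorem smul_dot {v φ : ι → F} (h : φ ⬝ᵥ v = 0) (a : F) : (a • φ) ⬝ᵥ v = 0 := by
  rw [smul_dotProduct, h, smul_zero]

/-- The root subgroup `a ↦ 1 + v ⊗ aφ`. -/
def root (v φ : ι → F) (h : φ ⬝ᵥ v = 0) (a : F) : SpecialLinearGroup ι F :=
  tv v (a • φ) (smul_dot h a)

theorem root_add {v φ : ι → F} (h : φ ⬝ᵥ v = 0) (a b : F) :
    root v φ h (a + b) = root v φ h a * root v φ h b := by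
  rw [root, root, root, ← tv_mul_left (h'' := by rw [← add_smul]; exact smul_dot h _)]
  exact tv_congr _ rfl (add_smul _ _ _)

section Embed

variable {i j : ι}

/-- The matrix whose columns are the coordinate vectors `i` and `j`. -/
def cols (F : Type*) [Field F] (i j : ι) : Matrix ι (Fin 2) F :=
  of fun k l => (if l = 0 then Pi.single i 1 else Pi.single j 1 : ι → F) k

theorem cols_transpose_mul (hij : i ≠ j) : (cols F i j)ᵀ * cols F i j = 1 := by
  ext a b
  fin_cases a <;> fin_cases b <;> simp [cols, mul_apply, Pi.single_apply, hij, hij.symm]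

/-- The embedding of `SL₂` in the coordinates `i, j`. -/
def embed (hij : i ≠ j) : SpecialLinearGroup (Fin 2) F →* SpecialLinearGroup ι F where
  toFun M := ⟨1 + cols F i j * ((M : Matrix (Fin 2) (Fin 2) F) - 1) * (cols F i j)ᵀ, by
    rw [Matrix.mul_assoc, det_one_add_mul_comm, Matrix.mul_assoc, cols_transpose_mul hij,
      Matrix.mul_one,
      add_sub_cancel, M.2]⟩
  map_one' := by
    refine sl_ext ?_
    simp
  map_mul' M N := by
    refine sl_ext ?_
    set P := cols F i j
    have h := cols_transpose_mul (F := F) hij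
    have : P * (M.1 - 1) * Pᵀ * (P * (N.1 - 1) * Pᵀ) = P * ((M.1 - 1) * (N.1 - 1)) * Pᵀ := by
      calc _ = P * (M.1 - 1) * (Pᵀ * P) * (N.1 - 1) * Pᵀ := by simp only [Matrix.mul_assoc]
        _ = _ := by rw [h]; simp only [Matrix.mul_assoc, Matrix.one_mul]
    change 1 + P * (M.1 * N.1 - 1) * Pᵀ = (1 + P * (M.1 - 1) * Pᵀ) * (1 + P * (N.1 - 1) * Pᵀ)
    rw [mul_add, add_mul, add_mul, this]
    simp only [Matrix.one_mul, Matrix.mul_one, Matrix.mul_sub, Matrix.sub_mul]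
    abel

theorem coe_embed (hij : i ≠ j) (M : SpecialLinearGroup (Fin 2) F) :
    (embed hij M : Matrix ι ι F) =
      1 + cols F i j * ((M : Matrix (Fin 2) (Fin 2) F) - 1) * (cols F i j)ᵀ := rfl

theorem single_dot (F : Type*) [Field F] (hij : i ≠ j) :
    (Pi.single j 1 : ι → F) ⬝ᵥ (Pi.single i 1 : ι → F) = 0 := by
  simp [hij]

theorem embed_upper (hij : i ≠ j) (a : F) :
    embed hij (SLTwo.upper a) = root (Pi.single i 1) (Pi.single j 1) (single_dot F hij) a := by
  ext k l
  simp [coe_embed, root, mul_apply, cols, Fin.sum_univ_two, vecMulVec_apply]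
  ring

theorem embed_lower (hij : i ≠ j) (a : F) :
    embed hij (SLTwo.lower a) =
      root (Pi.single j 1) (Pi.single i 1) (single_dot F hij.symm) a := by
  ext k l
  simp [coe_embed, root, mul_apply, cols, Fin.sum_univ_two, vecMulVec_apply]
  ring

theorem embed_torus (hij : i ≠ j) {c : F} (hc : c ≠ 0) :
    embed hij (SLTwo.torus (Units.mk0 c hc)⁻¹) = SpecialLinearGroup.diag2n hij c hc := by
  ext k l
  rw [Matrix.SpecialLinearGroup.diag2n_coe]
  simp [coe_embed, mul_apply, cols, Fin.sum_univ_two, one_apply, Pi.single_apply, diagonal_apply]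
  grind

theorem transvection_eq_root (hij : i ≠ j) (a : F) : SpecialLinearGroup.transvection hij a =
    root (Pi.single i 1) (Pi.single j 1) (single_dot F hij) a := by
  ext k l
  simp [Matrix.SpecialLinearGroup.transvection_coe, root, vecMulVec_apply, single_apply,
    Pi.single_apply]
  grind

end Embed

theorem generators [Nontrivial ι] {p : SpecialLinearGroup ι F → Prop}
    (hr : ∀ (i j : ι) (hij : i ≠ j) a,
      p (root (Pi.single i 1) (Pi.single j 1) (single_dot F hij) a))
    (hm : ∀ x y, p x → p y → p (x * y)) (g) : p g := by
  refine SpecialLinearGroup.diagonal_transvection_induction' p g (fun i j hij c hc => ?_)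
    (fun i j hij a => ?_) hm
  · rw [← embed_torus]
    refine SLTwo.generators (p := fun g => p (embed hij g)) (fun a => ?_) (fun a => ?_)
      (fun x y hx hy => ?_) _
    · rw [embed_upper]; exact hr _ _ hij _
    · rw [embed_lower]; exact hr _ _ hij.symm _
    · rw [map_mul]; exact hm _ _ hx hy
  · rw [transvection_eq_root]; exact hr _ _ hij _

end SLN

namespace SLN

open Matrix OrthRep

section Conj

variable {F : Type*} [Field F] {ι : Type*} [Fintype ι] [DecidableEq ι]

omit [DecidableEq ι] in
theorem exists_ne_zero_dot_eq_zero (h3 : 3 ≤ Fintype.card ι) (ψ₁ ψ₂ : ι → F) :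
    ∃ v : ι → F, v ≠ 0 ∧ ψ₁ ⬝ᵥ v = 0 ∧ ψ₂ ⬝ᵥ v = 0 := by
  have : LinearMap.ker (Matrix.mulVecLin (of ![ψ₁, ψ₂])) ≠ ⊥ :=
    LinearMap.ker_ne_bot_of_finrank_lt (by simp; omega)
  obtain ⟨v, hv, h0⟩ := Submodule.exists_mem_ne_zero_of_ne_bot this
  rw [LinearMap.mem_ker, mulVecLin_apply] at hv
  exact ⟨v, h0, congrFun hv 0, congrFun hv 1⟩

theorem exists_dot_eq {v w : ι → F} {i j : ι} (h : v i * w j ≠ v j * w i) (α β : F) :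
    ∃ θ : ι → F, θ ⬝ᵥ v = α ∧ θ ⬝ᵥ w = β := by
  have hD : v i * w j - v j * w i ≠ 0 := sub_ne_zero.2 h
  refine ⟨((α * w j - β * v j) / (v i * w j - v j * w i)) • Pi.single i 1 +
    ((β * v i - α * w i) / (v i * w j - v j * w i)) • Pi.single j 1, ?_, ?_⟩
  · simp only [add_dotProduct, smul_dotProduct, single_dotProduct, one_mul, smul_eq_mul]
    rw [div_mul_eq_mul_div, div_mul_eq_mul_div, ← add_div, div_eq_iff hD]
    ring
  · simp only [add_dotProduct, smul_dotProduct, single_dotProduct, one_mul, smul_eq_mul]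
    rw [div_mul_eq_mul_div, div_mul_eq_mul_div, ← add_div, div_eq_iff hD]
    ring

/-- The pairs `(v, φ)` and `(v', φ')` are in one orbit of the special linear group. -/
def Rel (v φ v' φ' : ι → F) : Prop :=
  ∃ g : SpecialLinearGroup ι F, (g : Matrix ι ι F) *ᵥ v = v' ∧ φ' ᵥ* (g : Matrix ι ι F) = φ

theorem Rel.trans {a b c a' b' c' : ι → F} (h : Rel a a' b b') (h' : Rel b b' c c') :
    Rel a a' c c' := by
  obtain ⟨g, h1, h2⟩ := h
  obtain ⟨g', h3, h4⟩ := h'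
  refine ⟨g' * g, ?_, ?_⟩
  · rw [Matrix.SpecialLinearGroup.coe_mul, ← mulVec_mulVec, h1, h3]
  · rw [Matrix.SpecialLinearGroup.coe_mul, ← vecMul_vecMul, h4, h2]

theorem rel_of_indep {φ v w : ι → F} (hv : φ ⬝ᵥ v = 0) (hw : φ ⬝ᵥ w = 0) {i j : ι}
    (h : v i * w j ≠ v j * w i) : Rel v φ w φ := by
  obtain ⟨θ, h1, h2⟩ := exists_dot_eq h 1 1
  refine ⟨tv (w - v) θ (by rw [dotProduct_sub, h1, h2, sub_self]), ?_, ?_⟩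
  · rw [coe_tv, add_mulVec, one_mulVec, vecMulVec_mulVec, h1]
    simp
  · rw [coe_tv, vecMul_add, vecMul_one, vecMul_vecMulVec, dotProduct_sub, hw, hv]
    simp

theorem rel_left (h3 : 3 ≤ Fintype.card ι) {φ v w : ι → F} (hv : φ ⬝ᵥ v = 0) (hw : φ ⬝ᵥ w = 0)
    (hv0 : v ≠ 0) (hw0 : w ≠ 0) : Rel v φ w φ := by
  by_cases h : ∃ i j, v i * w j ≠ v j * w i
  · obtain ⟨i, j, h⟩ := h
    exact rel_of_indep hv hw h
  · push Not at h
    obtain ⟨i, hi⟩ := Function.ne_iff.1 hv0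
    obtain ⟨k, hk⟩ := Function.ne_iff.1 hw0
    obtain ⟨u, hu0, hu, hui⟩ := exists_ne_zero_dot_eq_zero h3 φ (Pi.single i 1)
    obtain ⟨l, hl⟩ := Function.ne_iff.1 hu0
    simp only [single_dotProduct, one_mul, Pi.zero_apply] at hui hi hk hl
    have hwi : w i ≠ 0 := by
      have := h i k
      intro h0
      simp_all
    exact (rel_of_indep hv hu (i := i) (j := l) (by simp [hui, hi, hl])).trans
      (rel_of_indep hu hw (i := i) (j := l) (by simp [hui, hl, hwi]))

theorem rel_right (h3 : 3 ≤ Fintype.card ι) {v φ ψ : ι → F} (hφ : φ ⬝ᵥ v = 0) (hψ : ψ ⬝ᵥ v = 0)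
    (hφ0 : φ ≠ 0) (hψ0 : ψ ≠ 0) : Rel v φ v ψ := by
  obtain ⟨g, h1, h2⟩ := rel_left h3 (φ := v) (v := ψ) (w := φ) (by rwa [dotProduct_comm])
    (by rwa [dotProduct_comm]) hψ0 hφ0
  refine ⟨g.transpose, ?_, ?_⟩
  · rw [Matrix.SpecialLinearGroup.coe_transpose, mulVec_transpose, h2]
  · rw [Matrix.SpecialLinearGroup.coe_transpose, vecMul_transpose, h1]

theorem rel_of_card (h3 : 3 ≤ Fintype.card ι) {v φ w ψ : ι → F} (h : φ ⬝ᵥ v = 0) (h' : ψ ⬝ᵥ w = 0)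
    (hv : v ≠ 0) (hφ : φ ≠ 0) (hw : w ≠ 0) (hψ : ψ ≠ 0) : Rel v φ w ψ := by
  obtain ⟨u, hu, h1, h2⟩ := exists_ne_zero_dot_eq_zero h3 φ ψ
  exact ((rel_left h3 h h1 hv hu).trans (rel_right h3 h1 h2 hφ hψ)).trans
    (rel_left h3 h2 h' hu hw)

theorem isConj_tv (h3 : 3 ≤ Fintype.card ι) {v φ w ψ : ι → F} (h : φ ⬝ᵥ v = 0) (h' : ψ ⬝ᵥ w = 0)
    (hv : v ≠ 0) (hφ : φ ≠ 0) (hw : w ≠ 0) (hψ : ψ ≠ 0) : IsConj (tv v φ h) (tv w ψ h') := by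
  obtain ⟨g, h1, h2⟩ := rel_of_card h3 h h' hv hφ hw hψ
  exact isConj_iff.2 ⟨g, by rw [mul_tv h h' h1 h2, mul_inv_cancel_right]⟩

/-- The vectors annihilated by `e`. -/
def annih (e : ι → F) : AddSubgroup (ι → F) where
  carrier := {w | e ⬝ᵥ w = 0}
  add_mem' {a b} ha hb := by
    rw [Set.mem_ofPred_eq] at *
    rw [dotProduct_add, ha, hb, add_zero]
  zero_mem' := dotProduct_zero e
  neg_mem' {a} ha := by
    rw [Set.mem_ofPred_eq] at *
    rw [dotProduct_neg, ha, neg_zero]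

/-- The transvections with axis `e`. -/
def axis (e : ι → F) (w : annih e) : SpecialLinearGroup ι F := tv w e w.2

/-- The transvections with centre `e`. -/
def centre (e : ι → F) (φ : annih e) : SpecialLinearGroup ι F :=
  tv e φ (by rw [dotProduct_comm]; exact φ.2)

theorem axis_add (e : ι → F) (v w : annih e) : axis e (v + w) = axis e v * axis e w :=
  tv_mul_right _ _ _

theorem centre_add (e : ι → F) (v w : annih e) : centre e (v + w) = centre e v * centre e w :=
  tv_mul_left _ _ _

end Conj

section Rep

variable {V : Type*} [NormedAddCommGroup V] [InnerProductSpace ℝ V] [FiniteDimensional ℝ V]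

theorem card_mul_finrank_fixed {G : Type*} [Group G] {ρ : Representation ℝ G V} {M : Type*}
    [AddCommGroup M] [Fintype M] {u : M → G} (hu : ∀ a b, u (a + b) = u a * u b) {τ : ℝ}
    (hτ : ∀ a, a ≠ 0 → LinearMap.trace ℝ V (ρ (u a)) = τ) :
    (Fintype.card M : ℝ) * (Module.finrank ℝ (fixed ρ u) - τ) = Module.finrank ℝ V - τ := by
  classical
  have h0 : LinearMap.trace ℝ V (ρ (u 0)) = Module.finrank ℝ V := by
    rw [hom_zero hu, map_one, LinearMap.trace_one]
  have h : ∑ a, LinearMap.trace ℝ V (ρ (u a)) =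
      ∑ a : M, (τ + if a = 0 then (Module.finrank ℝ V : ℝ) - τ else 0) := by
    refine Finset.sum_congr rfl fun a _ => ?_
    split_ifs with ha
    · rw [ha, h0]; ring
    · rw [hτ a ha]; ring
  rw [Finset.sum_add_distrib, Finset.sum_ite_eq' Finset.univ (0 : M)] at h
  simp only [Finset.sum_const, Finset.card_univ, nsmul_eq_mul, Finset.mem_univ, if_true] at h
  rw [← trace_avg hu, trace_avg_eq_sum, h]
  have := card_ne_zero' M
  field_simp
  ring

variable {F : Type*} [Field F] [Fintype F] {ι : Type*} [Fintype ι] [DecidableEq ι]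
variable {ρ : Representation ℝ (SpecialLinearGroup ι F) V}

omit [FiniteDimensional ℝ V] [Fintype F] in
theorem fixed_centre_inf_fixed_axis [Nontrivial ι] (hinv : ∀ v, (∀ g, ρ g v = v) → v = 0) (o : ι) :
    fixed ρ (centre (Pi.single o 1)) ⊓ fixed ρ (axis (Pi.single o 1)) = ⊥ := by
  rw [eq_bot_iff]
  rintro v ⟨hc, ha⟩
  have hc' : ∀ φ h, ρ (tv (Pi.single o 1) φ h) v = v := fun φ h =>
    hc ⟨φ, by rw [dotProduct_comm] at h; exact h⟩
  have ha' : ∀ w h, ρ (tv w (Pi.single o 1) h) v = v := fun w h => ha ⟨w, h⟩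
  refine hinv v (generators (fun i j hij a => ?_) fun x y hx hy => ?_)
  · by_cases hi : i = o
    · subst hi
      exact hc' _ _
    have key : root (Pi.single i 1) (Pi.single j 1) (single_dot F hij) a =
        tv (a • Pi.single i 1) (Pi.single j 1)
          (by rw [dotProduct_smul, single_dot F hij, smul_zero]) := by
      refine sl_ext ?_
      simp only [root, coe_tv, vecMulVec_smul, smul_vecMulVec]
    rw [key]
    by_cases hj : j = o
    · subst hj
      exact ha' _ _
    have hio : (Pi.single o 1 : ι → F) ⬝ᵥ (a • Pi.single i 1 : ι → F) = 0 := by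
      rw [dotProduct_smul, single_dot F hi, smul_zero]
    have hji : (Pi.single j 1 : ι → F) ⬝ᵥ (a • Pi.single i 1 : ι → F) = 0 := by
      rw [dotProduct_smul, single_dot F hij, smul_zero]
    have hjo : (Pi.single j 1 : ι → F) ⬝ᵥ (Pi.single o 1 : ι → F) = 0 := single_dot F (Ne.symm hj)
    have hsum : (Pi.single j 1 : ι → F) ⬝ᵥ (Pi.single o 1 + a • Pi.single i 1 : ι → F) = 0 := by
      rw [dotProduct_add, hjo, hji, add_zero]
    have h1 : tv _ _ hio * tv _ _ hjo = tv _ _ hsum * tv _ _ hio := by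
      refine mul_tv hjo hsum ?_ ?_
      · rw [coe_tv, add_mulVec, one_mulVec, vecMulVec_mulVec]
        simp
      · rw [coe_tv, vecMul_add, vecMul_one, vecMul_vecMulVec, hji]
        simp
    rw [tv_mul_right hjo hji hsum] at h1
    have h2 := congrArg (fun g => ρ g v) h1
    simp only [rho_mul_apply, hc' _ hjo, ha' _ hio] at h2
    have h3 := congrArg (ρ (tv _ _ hjo)⁻¹) h2
    rw [rho_inv_apply_self] at h3
    rw [← h3]
    conv_lhs => rw [← hc' _ hjo]
    exact rho_inv_apply_self _ _ _
  · rw [rho_mul_apply, hy, hx]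

theorem finrank_fixed_root_le (h3 : 3 ≤ Fintype.card ι) (hρ : IsOrth ρ)
    (hinv : ∀ v, (∀ g, ρ g v = v) → v = 0) {v φ : ι → F} (h : φ ⬝ᵥ v = 0) (hv : v ≠ 0)
    (hφ : φ ≠ 0) :
    (Fintype.card F : ℝ) * Module.finrank ℝ (fixed ρ (root v φ h)) ≤
      6 * Module.finrank ℝ V := by
  classical
  have : Nontrivial ι := Fintype.one_lt_card_iff_nontrivial.1 (by omega)
  obtain ⟨i, j, hij⟩ := exists_pair_ne ι
  set ei : ι → F := Pi.single i 1 with hei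
  set ej : ι → F := Pi.single j 1 with hej
  have hi0 : ei ≠ 0 := by simp [ei]
  have hj0 : ej ≠ 0 := by simp [ej]
  set d : ℝ := ((Module.finrank ℝ V : ℕ) : ℝ)
  set τ := LinearMap.trace ℝ V (ρ (tv v φ h))
  have hτ : ∀ {w ψ : ι → F} (h' : ψ ⬝ᵥ w = 0), w ≠ 0 → ψ ≠ 0 →
      LinearMap.trace ℝ V (ρ (tv w ψ h')) = τ := fun h' hw hψ =>
    trace_conj_elt ρ (isConj_tv h3 h' h hw hψ hv hφ)
  have hroot : ∀ {w ψ : ι → F} (h' : ψ ⬝ᵥ w = 0), w ≠ 0 → ψ ≠ 0 →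
      (Fintype.card F : ℝ) * (Module.finrank ℝ (fixed ρ (root w ψ h')) - τ) = d - τ :=
    fun h' hw hψ => card_mul_finrank_fixed (root_add h') fun a ha =>
      hτ _ hw (smul_ne_zero ha hψ)
  have hτd := abs_le.1 (abs_trace_le hρ (tv v φ h))
  have hle : ∀ {N m : ℝ}, 0 < N → N * (m - τ) = d - τ → τ ≤ m := fun hN h => by
    have : 0 ≤ _ * (_ - τ) := h ▸ sub_nonneg.2 hτd.2
    exact sub_nonneg.1 (nonneg_of_mul_nonneg_right this hN)
  have hpos : ∀ {M : Type _} [AddCommGroup M] [Fintype M], (0 : ℝ) < Fintype.card M := by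
    intro M _ _
    exact_mod_cast Fintype.card_pos
  have hc := hle hpos (card_mul_finrank_fixed (ρ := ρ) (centre_add ei) fun a ha =>
    hτ _ hi0 fun h0 => ha (Subtype.ext h0))
  have ha := hle hpos (card_mul_finrank_fixed (ρ := ρ) (axis_add ei) fun a ha =>
    hτ _ (fun h0 => ha (Subtype.ext h0)) hi0)
  have hm := hroot h hv hφ
  have hU := hroot (single_dot F hij) hi0 hj0
  have hU' := hroot (single_dot F hij.symm) hj0 hi0
  set U := fixed ρ (root ei ej (single_dot F hij))
  set U' := fixed ρ (root ej ei (single_dot F hij.symm))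
  have hcU : fixed ρ (centre ei) ≤ U := fun x hx a =>
    hx ⟨a • ej, by
      change ei ⬝ᵥ a • ej = 0
      rw [dotProduct_smul, single_dot F hij.symm, smul_zero]⟩
  have haU : fixed ρ (axis ei) ≤ U' := fun x hx a => by
    have := hx ⟨a • ej, by
      change ei ⬝ᵥ a • ej = 0
      rw [dotProduct_smul, single_dot F hij.symm, smul_zero]⟩
    rw [← this]
    congr 2
    refine sl_ext ?_
    change 1 + vecMulVec ej (a • ei) = 1 + vecMulVec (a • ej) ei
    rw [vecMulVec_smul, smul_vecMulVec]
  have e1 := Submodule.finrank_sup_add_finrank_inf_eq U U'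
  have e2 := Submodule.finrank_sup_add_finrank_inf_eq (fixed ρ (centre ei)) (fixed ρ (axis ei))
  rw [fixed_centre_inf_fixed_axis hinv i, finrank_bot, add_zero] at e2
  have e3 := Submodule.finrank_mono (sup_le_sup hcU haU)
  have e4 : fixed (ρ.comp (embed hij)) id ≤ U ⊓ U' := fun x hx =>
    ⟨fun a => by rw [← embed_upper]; exact hx _, fun a => by rw [← embed_lower]; exact hx _⟩
  have e5 := Submodule.finrank_mono e4
  have e6 := SLTwo.finrank_fixed_le (ρ := ρ.comp (embed hij)) fun g => hρ _
  have e7 : fixed (ρ.comp (embed hij)) (SLTwo.upper : F → _) = U := by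
    ext x
    refine forall_congr' fun a => ?_
    rw [← embed_upper]
    rfl
  rw [e7] at e6
  have hq : (0 : ℝ) < Fintype.card F  := by exact_mod_cast Fintype.card_pos
  rify at e1 e2 e3 e5
  set q : ℝ := ((Fintype.card F : ℕ) : ℝ)
  have hd : (0 : ℝ) ≤ d := Nat.cast_nonneg _
  have f1 : (Module.finrank ℝ (fixed (ρ.comp (embed hij)) id) : ℝ) ≤
    Module.finrank ℝ U + Module.finrank ℝ U' - 2 * τ := by linarith
  have f2 := mul_le_mul_of_nonneg_left f1 (by linarith : 0 ≤ q + 1)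
  set mU : ℝ := ((Module.finrank ℝ U : ℕ) : ℝ)
  have hmU : (Module.finrank ℝ (fixed ρ (root v φ h)) : ℝ) = mU := by
    have := mul_left_cancel₀ hq.ne' (hm.trans hU.symm)
    linarith
  have hmU' : (Module.finrank ℝ U' : ℝ) = mU := by
    have := mul_left_cancel₀ hq.ne' (hU'.trans hU.symm)
    linarith
  rw [hmU]
  rw [hmU'] at f2
  have f3 : (q + 1) * mU ≤ (q + 1) * (mU + mU - 2 * τ) + 2 * d := e6.trans (by linarith)
  have f4 := mul_le_mul_of_nonneg_left f3 hq.le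
  have f5 : (q + 1) * (d - τ) ≤ (q + 1) * (2 * d) :=
    mul_le_mul_of_nonneg_left (by linarith) (by linarith)
  refine le_of_mul_le_mul_left ?_ (by linarith : 0 < q + 1)
  rw [← hU] at f5
  nlinarith

end Rep
end SLN

namespace OrthRep

variable {G : Type*} [Group G] [Fintype G]
variable {M : Type*} [AddCommGroup M] [Fintype M]

/-- The average over the group of the conjugates of `avg ρ u`. -/
noncomputable def conjAvg {V : Type*} [NormedAddCommGroup V] [InnerProductSpace ℝ V]
    (ρ : Representation ℝ G V) (u : M → G) : V →ₗ[ℝ] V :=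
  (Fintype.card G : ℝ)⁻¹ • ∑ g, ρ g * avg ρ u * ρ g⁻¹

/-- The matrix coefficient of `f` is invariant under conjugation. -/
def IsTracial {V : Type*} [NormedAddCommGroup V] [InnerProductSpace ℝ V]
    (ρ : Representation ℝ G V) (f : V) : Prop :=
  ∀ x y, ⟪ρ (x * y) f, f⟫_ℝ = ⟪ρ (y * x) f, f⟫_ℝ

section

variable {V : Type*} [NormedAddCommGroup V] [InnerProductSpace ℝ V]
variable {ρ : Representation ℝ G V} {u : M → G}

omit [AddCommGroup M] in
theorem conjAvg_apply (v : V) :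
    conjAvg ρ u v = (Fintype.card G : ℝ)⁻¹ • ∑ g, ρ g (avg ρ u (ρ g⁻¹ v)) := by
  simp [conjAvg]

omit [AddCommGroup M] in
theorem conjAvg_rho (h : G) (v : V) : conjAvg ρ u (ρ h v) = ρ h (conjAvg ρ u v) := by
  rw [conjAvg_apply, conjAvg_apply, map_smul, map_sum]
  congr 1
  exact Fintype.sum_equiv (Equiv.mulLeft h⁻¹) _ _ fun g => by
    rw [Equiv.coe_mulLeft, ← rho_mul_apply ρ h, ← rho_mul_apply ρ g⁻¹]
    simp

theorem conjAvg_symmetric (hρ : IsOrth ρ) (hu : ∀ a b, u (a + b) = u a * u b) :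
    (conjAvg ρ u).IsSymmetric := by
  intro v w
  rw [conjAvg_apply, conjAvg_apply, inner_smul_left, inner_smul_right, sum_inner, inner_sum]
  simp only [conj_trivial]
  congr 1
  refine Finset.sum_congr rfl fun g _ => ?_
  rw [hρ.inner_left, inner_avg hρ hu, hρ.inner_left, inv_inv]

omit [AddCommGroup M] in
theorem inner_conjAvg {f : V} (hf : IsTracial ρ f) :
    ⟪conjAvg ρ u f, f⟫_ℝ = ⟪avg ρ u f, f⟫_ℝ := by
  have h : ∀ g, ⟪ρ g (avg ρ u (ρ g⁻¹ f)), f⟫_ℝ = ⟪avg ρ u f, f⟫_ℝ := fun g => by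
    rw [avg_apply, avg_apply, map_smul, map_sum, inner_smul_left, inner_smul_left, sum_inner,
      sum_inner]
    congr 1
    refine Finset.sum_congr rfl fun a _ => ?_
    rw [← rho_mul_apply, ← rho_mul_apply, hf, ← mul_assoc, inv_mul_cancel, one_mul]
  rw [conjAvg_apply, inner_smul_left, sum_inner, Finset.sum_congr rfl fun g _ => h g]
  simp

omit [AddCommGroup M] in
theorem coe_conjAvg_sub {E : Submodule ℝ V} (hE : ∀ g, E ≤ E.comap (ρ g)) (v : E) :
    (conjAvg (ρ.subrepresentation E hE) u v : V) = conjAvg ρ u v := by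
  have h : ∀ w : E, (avg (ρ.subrepresentation E hE) u w : V) = avg ρ u w := fun w => by
    rw [avg_apply, avg_apply, Submodule.coe_smul, Submodule.coe_sum]
    rfl
  rw [conjAvg_apply, conjAvg_apply, Submodule.coe_smul, Submodule.coe_sum]
  refine congrArg _ (Finset.sum_congr rfl fun g _ => ?_)
  change ρ g (avg (ρ.subrepresentation E hE) u _ : V) = _
  rw [h]
  rfl

variable [FiniteDimensional ℝ V]

theorem trace_conjAvg (hu : ∀ a b, u (a + b) = u a * u b) :
    LinearMap.trace ℝ V (conjAvg ρ u) = Module.finrank ℝ (fixed ρ u) := by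
  simp only [conjAvg, map_smul, map_sum, trace_conj_rep, trace_avg hu]
  simp

theorem inner_le_of_eigenvalue_le {T : V →ₗ[ℝ] V} (hT : T.IsSymmetric) {c : ℝ}
    (hc : ∀ μ, Module.End.HasEigenvalue T μ → μ ≤ c) (f : V) : ⟪T f, f⟫_ℝ ≤ c * ‖f‖ ^ 2 := by
  set b := hT.eigenvectorBasis rfl
  rw [← b.sum_inner_mul_inner, ← b.sum_sq_inner_right, Finset.mul_sum]
  refine Finset.sum_le_sum fun i _ => ?_
  have h : T (b i) = hT.eigenvalues rfl i • b i := hT.apply_eigenvectorBasis rfl i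
  rw [hT, h, inner_smul_right, real_inner_comm f, mul_assoc, ← sq, real_inner_comm]
  exact mul_le_mul_of_nonneg_right (hc _ (hT.hasEigenvalue_eigenvalues rfl i)) (sq_nonneg _)

theorem norm_avg_sq_le_of_sub (hρ : IsOrth ρ) (hu : ∀ a b, u (a + b) = u a * u b) {c : ℝ}
    (hc : ∀ (E : Submodule ℝ V) (hE : ∀ g, E ≤ E.comap (ρ g)),
      (Module.finrank ℝ (fixed (ρ.subrepresentation E hE) u) : ℝ) ≤ c * Module.finrank ℝ E)
    {f : V} (hf : IsTracial ρ f) : ‖avg ρ u f‖ ^ 2 ≤ c * ‖f‖ ^ 2 := by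
  rw [← inner_avg_self hρ hu, ← inner_conjAvg hf]
  refine inner_le_of_eigenvalue_le (conjAvg_symmetric hρ hu) (fun μ hμ => ?_) f
  set E := Module.End.eigenspace (conjAvg ρ u) μ with hEdef
  have hE : ∀ g, E ≤ E.comap (ρ g) := fun g v hv => by
    rw [Submodule.mem_comap, hEdef, Module.End.mem_eigenspace_iff, conjAvg_rho,
      Module.End.mem_eigenspace_iff.1 hv, map_smul]
  have h1 : conjAvg (ρ.subrepresentation E hE) u = μ • 1 := by
    ext v
    rw [coe_conjAvg_sub]
    exact Module.End.mem_eigenspace_iff.1 v.2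
  have h2 := trace_conjAvg (ρ := ρ.subrepresentation E hE) hu
  rw [h1, map_smul, LinearMap.trace_one, smul_eq_mul] at h2
  have h3 := hc E hE
  rw [← h2] at h3
  have hpos : 0 < Module.finrank ℝ E := by
    have : Nontrivial E := Submodule.nontrivial_iff_ne_bot.2 hμ
    exact Module.finrank_pos
  exact le_of_mul_le_mul_right h3 (by exact_mod_cast hpos)

end

/-- In every orthogonal representation without invariants, the vectors fixed by `u` form a
subspace of proportion at most `c`. -/
def SmallFixed {G M : Type} [Group G] (u : M → G) (c : ℝ) : Prop :=
  ∀ (V : Type) [NormedAddCommGroup V] [InnerProductSpace ℝ V] [FiniteDimensional ℝ V]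
    (ρ : Representation ℝ G V), IsOrth ρ → (∀ v, (∀ g, ρ g v = v) → v = 0) →
    (Module.finrank ℝ (fixed ρ u) : ℝ) ≤ c * Module.finrank ℝ V

theorem norm_avg_sq_le {G M V : Type} [Group G] [Fintype G] [AddCommGroup M] [Fintype M]
    [NormedAddCommGroup V] [InnerProductSpace ℝ V]
    [FiniteDimensional ℝ V] {ρ : Representation ℝ G V} {u : M → G}
    (hρ : IsOrth ρ) (hu : ∀ a b, u (a + b) = u a * u b) {c : ℝ}
    (hc : SmallFixed u c) (hinv : ∀ v, (∀ g, ρ g v = v) → v = 0)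
    {f : V} (hf : IsTracial ρ f) : ‖avg ρ u f‖ ^ 2 ≤ c * ‖f‖ ^ 2 :=
  norm_avg_sq_le_of_sub hρ hu (fun E hE => hc E _ (hρ.sub hE) fun v hv =>
    Subtype.ext (hinv v fun g => congrArg Subtype.val (hv g))) hf

end OrthRep

namespace OrthRep

section Coeff

variable {G : Type*} [Group G] {M : Type*} [AddCommGroup M]
variable {V : Type*} [NormedAddCommGroup V] [InnerProductSpace ℝ V]
variable {ρ : Representation ℝ G V} {u : M → G} {f : V}

theorem IsTracial.conj (hf : IsTracial ρ f) (x y : G) :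
    ⟪ρ (y * x * y⁻¹) f, f⟫_ℝ = ⟪ρ x f, f⟫_ℝ := by
  rw [hf, ← mul_assoc, inv_mul_cancel, one_mul]

theorem inner_rho_inv (hρ : IsOrth ρ) (x : G) : ⟪ρ x⁻¹ f, f⟫_ℝ = ⟪ρ x f, f⟫_ℝ := by
  rw [hρ.inner_left, inv_inv, real_inner_comm]

variable [Fintype M]

theorem norm_sum_conj_sq (hρ : IsOrth ρ) (hf : IsTracial ρ f)
    (hu : ∀ a b, u (a + b) = u a * u b) (x : G) :
    ‖∑ c, ρ (u c * x * u (-c)) f‖ ^ 2 =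
      Fintype.card M * ∑ c, ⟪ρ (x * u c * x⁻¹ * u (-c)) f, f⟫_ℝ := by
  have key : ∀ c d, ⟪ρ (u c * x * u (-c)) f, ρ (u d * x * u (-d)) f⟫_ℝ =
      ⟪ρ (x * u (c - d) * x⁻¹ * u (-(c - d))) f, f⟫_ℝ := fun c d => by
    obtain ⟨e, rfl⟩ : ∃ e, c = d + e := ⟨c - d, by abel⟩
    rw [hρ.inner_right, ← rho_mul_apply, ← inner_rho_inv hρ, add_sub_cancel_left, hom_neg hu,
      hom_neg hu, hom_neg hu, hu,
      ← hf.conj (x * u e * x⁻¹ * (u e)⁻¹) (u d * u e * x⁻¹ * (u e)⁻¹)]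
    congr 3
    group
  rw [← real_inner_self_eq_norm_sq, sum_inner]
  simp only [inner_sum, key]
  rw [Finset.sum_comm, ← nsmul_eq_mul, ← Finset.card_univ, ← Finset.sum_const]
  exact Finset.sum_congr rfl fun d _ => Fintype.sum_equiv (Equiv.subRight d) _ _ fun c => rfl

theorem sq_inner_le (hρ : IsOrth ρ) (hf : IsTracial ρ f)
    (hu : ∀ a b, u (a + b) = u a * u b) (x : G) (w : V)
    (hw : ∀ g h, ⟪ρ (h * g * h⁻¹) f, w⟫_ℝ = ⟪ρ g f, w⟫_ℝ) :
    Fintype.card M * ⟪ρ x f, w⟫_ℝ ^ 2 ≤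
      (∑ c, ⟪ρ (x * u c * x⁻¹ * u (-c)) f, f⟫_ℝ) * ‖w‖ ^ 2 := by
  have h1 : Fintype.card M * ⟪ρ x f, w⟫_ℝ = ⟪∑ c, ρ (u c * x * u (-c)) f, w⟫_ℝ := by
    rw [sum_inner, Finset.sum_congr rfl fun c _ => by rw [hom_neg hu, hw]]
    simp
  have h2 := real_inner_mul_inner_self_le (∑ c, ρ (u c * x * u (-c)) f) w
  rw [← h1, real_inner_self_eq_norm_sq, real_inner_self_eq_norm_sq, norm_sum_conj_sq hρ hf hu] at h2
  have hM : (0 : ℝ) < Fintype.card M := by exact_mod_cast Fintype.card_pos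
  refine le_of_mul_le_mul_left ?_ hM
  linarith

theorem inner_rho_le_of_conj (hρ : IsOrth ρ) (hf : IsTracial ρ f)
    (hu : ∀ a b, u (a + b) = u a * u b) (x : G) (h : ∀ a, ∃ y, y * x * y⁻¹ = u a * x) :
    ⟪ρ x f, f⟫_ℝ ≤ ‖avg ρ u f‖ ^ 2 := by
  have h1 : ⟪avg ρ u (ρ x f), f⟫_ℝ = ⟪ρ x f, f⟫_ℝ := by
    rw [avg_apply, inner_smul_left, sum_inner, Finset.sum_congr rfl fun a _ => by
      obtain ⟨y, hy⟩ := h a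
      rw [← rho_mul_apply, ← hy, hf.conj]]
    simp
  have h2 : ‖avg ρ u (ρ x f)‖ ^ 2 = ‖avg ρ u f‖ ^ 2 := by
    rw [← inner_avg_self hρ hu, ← inner_avg_self hρ hu, avg_apply, avg_apply, inner_smul_left,
      inner_smul_left, sum_inner, sum_inner]
    congr 1
    refine Finset.sum_congr rfl fun a _ => ?_
    rw [hρ.inner_right, ← rho_mul_apply, ← rho_mul_apply, ← hf.conj (u a) x⁻¹, inv_inv, mul_assoc]
  have h3 : ‖avg ρ u (ρ x f)‖ = ‖avg ρ u f‖ :=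
    (sq_eq_sq₀ (norm_nonneg _) (norm_nonneg _)).1 h2
  rw [← h1, ← avg_avg hu, inner_avg hρ hu, sq]
  refine (real_inner_le_norm _ _).trans ?_
  rw [h3]

end Coeff

end OrthRep

namespace SLN

open Matrix OrthRep

section

variable {F : Type*} [Field F] {ι : Type*} [Fintype ι] [DecidableEq ι]

theorem exists_indep_of_not_mem_center {g : SpecialLinearGroup ι F}
    (hg : g ∉ Subgroup.center (SpecialLinearGroup ι F)) :
    ∃ v : ι → F, ∃ i j, v i * ((g : Matrix ι ι F) *ᵥ v) j ≠ v j * ((g : Matrix ι ι F) *ᵥ v) i := by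
  by_contra! h
  refine hg ?_
  have hoff : ∀ j k, j ≠ k → g.1 j k = 0 := fun j k hjk => by
    have := h (Pi.single k 1) k j
    simpa [hjk] using this
  have hdiag : ∀ j k, g.1 j j = g.1 k k := fun j k => by
    by_cases hjk : j = k
    · rw [hjk]
    have := h (Pi.single j 1 + Pi.single k 1) k j
    simpa [hjk, Ne.symm hjk, mulVec_add, hoff] using this
  rcases isEmpty_or_nonempty ι with hι | ⟨⟨o⟩⟩
  · rw [Subsingleton.elim g 1]
    exact one_mem _
  have hs : scalar ι (g.1 o o) = g.1 := by
    ext j k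
    by_cases hjk : j = k
    · subst hjk; simp [hdiag o j]
    · simp [hjk, hoff]
  refine Matrix.SpecialLinearGroup.mem_center_iff.2 ⟨g.1 o o, ?_, hs⟩
  have := g.2
  rw [← hs] at this
  simpa using this

theorem exists_fixed_of_rank_two (h3 : 3 ≤ Fintype.card ι) {x : SpecialLinearGroup ι F}
    (hx : x ≠ 1) {v w a b : ι → F} (h : (x : Matrix ι ι F) = 1 + vecMulVec v a + vecMulVec w b) :
    ∃ e φ : ι → F, e ≠ 0 ∧ (x : Matrix ι ι F) *ᵥ e = e ∧ φ ⬝ᵥ e = 0 ∧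
      φ ᵥ* (x : Matrix ι ι F) ≠ φ := by
  have hfix : ∀ {e}, a ⬝ᵥ e = 0 → b ⬝ᵥ e = 0 → (x : Matrix ι ι F) *ᵥ e = e := fun ha hb => by
    rw [h, add_mulVec, add_mulVec, one_mulVec, vecMulVec_mulVec, vecMulVec_mulVec, ha, hb]
    simp
  have key : ∀ {e z : ι → F} {i j : ι}, e ≠ 0 → (x : Matrix ι ι F) *ᵥ e = e →
      e i * ((x : Matrix ι ι F) *ᵥ z - z) j ≠ e j * ((x : Matrix ι ι F) *ᵥ z - z) i →
      ∃ e φ : ι → F, e ≠ 0 ∧ (x : Matrix ι ι F) *ᵥ e = e ∧ φ ⬝ᵥ e = 0 ∧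
      φ ᵥ* (x : Matrix ι ι F) ≠ φ := by
    intro e z i j he hxe hz
    obtain ⟨φ, h1, h2⟩ := exists_dot_eq hz 0 1
    refine ⟨e, φ, he, hxe, h1, fun hφ => ?_⟩
    rw [dotProduct_sub, dotProduct_mulVec, hφ, sub_self] at h2
    exact zero_ne_one h2
  obtain ⟨e, he, hae, hbe⟩ := exists_ne_zero_dot_eq_zero h3 a b
  have hxe := hfix hae hbe
  by_cases hz : ∃ z i j,
      e i * ((x : Matrix ι ι F) *ᵥ z - z) j ≠ e j * ((x : Matrix ι ι F) *ᵥ z - z) i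
  · obtain ⟨z, i, j, hz⟩ := hz
    exact key he hxe hz
  push Not at hz
  obtain ⟨z, hz0⟩ : ∃ z, (x : Matrix ι ι F) *ᵥ z - z ≠ 0 := by
    by_contra! h0
    refine hx (sl_ext (ext_of_mulVec_single fun k => ?_))
    rw [sub_eq_zero.1 (h0 _), Matrix.SpecialLinearGroup.coe_one, one_mulVec]
  obtain ⟨i, hi⟩ := Function.ne_iff.1 he
  rw [Pi.zero_apply] at hi
  obtain ⟨e', he', h1, h2⟩ := exists_ne_zero_dot_eq_zero h3 ((x : Matrix ι ι F) i - Pi.single i 1)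
    (Pi.single i 1)
  simp only [sub_dotProduct, single_dotProduct, one_mul] at h1 h2
  have hi' : ((x : Matrix ι ι F) *ᵥ e' - e') i = 0 := h1
  have hxe' : (x : Matrix ι ι F) *ᵥ e' = e' := by
    refine sub_eq_zero.1 (funext fun k => ?_)
    have := hz e' i k
    rw [hi', mul_zero] at this
    exact (mul_eq_zero.1 this).resolve_left hi
  obtain ⟨k, hk⟩ := Function.ne_iff.1 hz0
  obtain ⟨l, hl⟩ := Function.ne_iff.1 he'
  have hzi : ((x : Matrix ι ι F) *ᵥ z - z) i ≠ 0 := fun h0 => by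
    have := hz z i k
    rw [h0, mul_zero] at this
    exact hk ((mul_eq_zero.1 this).resolve_left hi)
  refine key (i := i) (j := l) (z := z) he' hxe' ?_
  rw [h2, zero_mul]
  exact (mul_ne_zero hl hzi).symm

theorem exists_conj_eq_root_mul {x : SpecialLinearGroup ι F} {e φ : ι → F}
    (he : (x : Matrix ι ι F) *ᵥ e = e) (hφ : φ ⬝ᵥ e = 0) (hne : φ ᵥ* (x : Matrix ι ι F) ≠ φ) :
    ∃ θ : ι → F, ∃ hθ : θ ⬝ᵥ e = 0, θ ≠ 0 ∧ ∀ s, ∃ y, y * x * y⁻¹ = root e θ hθ s * x := by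
  have hx1 : (x : Matrix ι ι F) * (x⁻¹ : SpecialLinearGroup ι F).1 = 1 := by
    rw [← Matrix.SpecialLinearGroup.coe_mul, mul_inv_cancel, Matrix.SpecialLinearGroup.coe_one]
  have hx2 : (x⁻¹ : SpecialLinearGroup ι F).1 * (x : Matrix ι ι F) = 1 := by
    rw [← Matrix.SpecialLinearGroup.coe_mul, inv_mul_cancel, Matrix.SpecialLinearGroup.coe_one]
  set ψ := φ ᵥ* (x⁻¹ : SpecialLinearGroup ι F).1 with hψ
  have hψx : ψ ᵥ* (x : Matrix ι ι F) = φ := by rw [hψ, vecMul_vecMul, hx2, vecMul_one]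
  have hψe : ψ ⬝ᵥ e = 0 := by
    rw [← he, dotProduct_mulVec, hψx, hφ]
  refine ⟨φ - ψ, by rw [sub_dotProduct, hφ, hψe, sub_zero], fun h0 => hne ?_, fun s =>
    ⟨tv e (s • φ) (smul_dot hφ s), ?_⟩⟩
  · conv_rhs => rw [← hψx, ← sub_eq_zero.1 h0]
  · have h1 : x * tv e (s • φ) (smul_dot hφ s) = tv e (s • ψ) (smul_dot hψe s) * x :=
      mul_tv _ _ he (by rw [smul_vecMul, hψx])
    rw [mul_inv_eq_iff_eq_mul, mul_assoc, h1, ← mul_assoc, root, ← tv_mul_left (h'' := by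
      rw [add_dotProduct, smul_dot hψe, smul_dot (by rw [sub_dotProduct, hφ, hψe, sub_zero]),
        add_zero])]
    congr 1
    exact tv_congr _ rfl (by rw [← smul_add, sub_add_cancel])

theorem exists_conj_commutator (h3 : 3 ≤ Fintype.card ι) (g : SpecialLinearGroup ι F) {v φ : ι → F}
    (hφ : φ ⬝ᵥ v = 0) (hφ0 : φ ≠ 0) {i j : ι}
    (hv : v i * ((g : Matrix ι ι F) *ᵥ v) j ≠ v j * ((g : Matrix ι ι F) *ᵥ v) i) :
    ∃ e θ : ι → F, ∃ hθ : θ ⬝ᵥ e = 0, e ≠ 0 ∧ θ ≠ 0 ∧ ∀ s, ∃ y,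
      y * (g * tv v φ hφ * g⁻¹ * (tv v φ hφ)⁻¹) * y⁻¹ =
        root e θ hθ s * (g * tv v φ hφ * g⁻¹ * (tv v φ hφ)⁻¹) := by
  have hx1 : (g⁻¹ : SpecialLinearGroup ι F).1 * (g : Matrix ι ι F) = 1 := by
    rw [← Matrix.SpecialLinearGroup.coe_mul, inv_mul_cancel, Matrix.SpecialLinearGroup.coe_one]
  set a := φ ᵥ* (g⁻¹ : SpecialLinearGroup ι F).1 with ha
  have hag : a ᵥ* (g : Matrix ι ι F) = φ := by rw [ha, vecMul_vecMul, hx1, vecMul_one]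
  have h1 : g * tv v φ hφ * g⁻¹ = tv ((g : Matrix ι ι F) *ᵥ v) a
      (by rw [dotProduct_mulVec, hag, hφ]) := by
    rw [mul_inv_eq_iff_eq_mul]
    exact mul_tv _ _ rfl hag
  have hneg : (-φ) ⬝ᵥ v = 0 := by rw [neg_dotProduct, hφ, neg_zero]
  have h2 : (tv v φ hφ)⁻¹ = tv v (-φ) hneg := by
    rw [inv_eq_iff_mul_eq_one, ← tv_mul_left (h'' := by simp)]
    refine sl_ext ?_
    simp
  have hx : g * tv v φ hφ * g⁻¹ * (tv v φ hφ)⁻¹ ≠ 1 := fun h0 => by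
    rw [mul_inv_eq_one, mul_inv_eq_iff_eq_mul] at h0
    have h0 := congrArg Subtype.val h0
    simp only [Matrix.SpecialLinearGroup.coe_mul, coe_tv, mul_add, add_mul, Matrix.mul_one,
      Matrix.one_mul, mul_vecMulVec, vecMulVec_mul, add_right_inj] at h0
    obtain ⟨k, hk⟩ := Function.ne_iff.1 hφ0
    have e1 := congrFun (congrFun h0 i) k
    have e2 := congrFun (congrFun h0 j) k
    simp only [vecMulVec_apply] at e1 e2
    refine hv (mul_right_cancel₀ hk ?_)
    rw [mul_assoc, mul_assoc, e1, e2]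
    ring
  obtain ⟨e, ψ, he, hxe, hψ, hne⟩ := exists_fixed_of_rank_two h3 hx
    (v := (g : Matrix ι ι F) *ᵥ v) (a := a - (a ⬝ᵥ v) • φ) (w := v) (b := -φ) (by
      rw [h1, h2, Matrix.SpecialLinearGroup.coe_mul, coe_tv, coe_tv, mul_add,
    add_mul, add_mul,
        vecMulVec_mul_vecMulVec]
      simp [vecMulVec_sub, vecMulVec_smul, vecMulVec_neg]
      abel)
  obtain ⟨θ, hθ, hθ0, hθs⟩ := exists_conj_eq_root_mul hxe hψ hne
  exact ⟨e, θ, hθ, he, hθ0, hθs⟩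

end

end SLN

namespace SLTwo

open Matrix OrthRep

section

variable {F : Type*} [Field F]

theorem det_eq_one (x : SpecialLinearGroup (Fin 2) F) :
    x.1 0 0 * x.1 1 1 - x.1 0 1 * x.1 1 0 = 1 := by
  rw [← det_fin_two, x.2]

theorem exists_form_eq_one [Fintype F] {a b c d : F} (h : (d - a) ^ 2 + 4 * (b * c) ≠ 0) :
    ∃ v w : F, c * v ^ 2 + (d - a) * (v * w) - b * w ^ 2 = 1 := by
  by_cases hc : c = 0
  · have hda : d - a ≠ 0 := fun h0 => h (by rw [h0, hc]; ring)
    refine ⟨(1 + b) / (d - a), 1, ?_⟩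
    field_simp
    rw [hc]
    ring
  by_cases h2 : ringChar F = 2
  · obtain ⟨r, hr⟩ := FiniteField.isSquare_of_char_two h2 c⁻¹
    refine ⟨r, 0, ?_⟩
    rw [sq, ← hr]
    field_simp
    ring
  have h20 : (2 : F) ≠ 0 := Ring.two_ne_zero h2
  set Δ := (d - a) ^ 2 + 4 * (b * c)
  obtain ⟨s, t, hst⟩ := FiniteField.exists_root_sum_quadratic
    (f := (Polynomial.X ^ 2 : Polynomial F))
    (g := Polynomial.C (-Δ) * Polynomial.X ^ 2 + Polynomial.C 0 * Polynomial.X +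
      Polynomial.C (-(4 * c)))
    (Polynomial.degree_X_pow 2) (Polynomial.degree_quadratic (neg_ne_zero.2 h))
    (FiniteField.odd_card_of_char_ne_two h2)
  simp only [Polynomial.eval_add, Polynomial.eval_mul, Polynomial.eval_pow, Polynomial.eval_X,
    Polynomial.eval_C] at hst
  refine ⟨(s - (d - a) * t) / (2 * c), t, ?_⟩
  have h4 : 4 * c ≠ 0 := mul_ne_zero (by convert mul_ne_zero h20 h20 using 1; norm_num) hc
  refine mul_left_cancel₀ h4 ?_
  field_simp
  linear_combination 4 * hst

/-- The companion matrix of `X ^ 2 - τ X + 1`. -/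
def companion (τ : F) : SpecialLinearGroup (Fin 2) F := ⟨!![0, -1; 1, τ], by simp [det_fin_two]⟩

theorem isConj_companion [Fintype F] {x : SpecialLinearGroup (Fin 2) F} {τ : F}
    (hτ : x.1 0 0 + x.1 1 1 = τ) (h : τ ^ 2 ≠ 4) : IsConj (companion τ) x := by
  have hdet := det_eq_one x
  set a := x.1 0 0 with ha
  set b := x.1 0 1 with hb
  set c := x.1 1 0 with hc
  set d := x.1 1 1 with hd
  obtain ⟨v, w, hvw⟩ := exists_form_eq_one (a := a) (b := b) (c := c) (d := d) fun h0 => h (by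
    rw [← hτ]; linear_combination h0 + 4 * hdet)
  obtain ⟨H, hH⟩ : ∃ H : SpecialLinearGroup (Fin 2) F,
      H.1 = !![v, a * v + b * w; w, c * v + d * w] := ⟨⟨_, by
    rw [det_fin_two_of]; linear_combination hvw⟩, rfl⟩
  refine isConj_iff.2 ⟨H, ?_⟩
  rw [mul_inv_eq_iff_eq_mul]
  refine SLN.sl_ext ?_
  rw [Matrix.SpecialLinearGroup.coe_mul, Matrix.SpecialLinearGroup.coe_mul, hH]
  change _ * !![0, -1; 1, τ] = _
  rw [eta_fin_two x.1, ← ha, ← hb, ← hc, ← hd, ← hτ]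
  ext i j
  fin_cases i <;> fin_cases j <;> simp
  · linear_combination v * hdet
  · linear_combination w * hdet

theorem isConj_of_trace [Fintype F] {x y : SpecialLinearGroup (Fin 2) F} {τ : F}
    (hx : x.1 0 0 + x.1 1 1 = τ) (hy : y.1 0 0 + y.1 1 1 = τ) (h : τ ^ 2 ≠ 4) : IsConj x y :=
  (isConj_companion hx h).symm.trans (isConj_companion hy h)

theorem trace_commutator (g : SpecialLinearGroup (Fin 2) F) (a : F) :
    (g * upper a * g⁻¹ * upper (-a)).1 0 0 + (g * upper a * g⁻¹ * upper (-a)).1 1 1 =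
      2 + (g.1 1 0 * a) ^ 2 := by
  have hdet := det_eq_one g
  simp [Matrix.SpecialLinearGroup.coe_mul, Matrix.SpecialLinearGroup.coe_inv, mul_apply,
    Fin.sum_univ_two, adjugate_fin_two]
  linear_combination 2 * hdet

theorem trace_lower_upper (c : F) :
    (lower 1 * upper c).1 0 0 + (lower 1 * upper c).1 1 1 = 2 + c := by
  simp [Matrix.SpecialLinearGroup.coe_mul, mul_apply, Fin.sum_univ_two]
  ring

theorem exists_conj_entry_ne_zero {g : SpecialLinearGroup (Fin 2) F}
    (hg : g ∉ Subgroup.center (SpecialLinearGroup (Fin 2) F)) :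
    ∃ h : SpecialLinearGroup (Fin 2) F, (h * g * h⁻¹).1 1 0 ≠ 0 := by
  obtain ⟨v, i, j, hv⟩ := SLN.exists_indep_of_not_mem_center hg
  have hv' : v 0 * (g.1 *ᵥ v) 1 ≠ v 1 * (g.1 *ᵥ v) 0 := by
    fin_cases i <;> fin_cases j
    · exact absurd rfl hv
    · exact hv
    · exact hv.symm
    · exact absurd rfl hv
  obtain ⟨h, h0, h1⟩ : ∃ h : SpecialLinearGroup (Fin 2) F, h.1 0 0 = v 0 ∧ h.1 1 0 = v 1 := by
    by_cases h0 : v 0 = 0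
    · have h1 : v 1 ≠ 0 := fun h1 => hv' (by rw [h0, h1]; ring)
      exact ⟨⟨!![v 0, -(v 1)⁻¹; v 1, 0], by simp [det_fin_two, h1]⟩, rfl, rfl⟩
    · exact ⟨⟨!![v 0, 0; v 1, (v 0)⁻¹], by simp [det_fin_two, h0]⟩, rfl, rfl⟩
  refine ⟨h⁻¹, fun hz => hv' ?_⟩
  rw [inv_inv] at hz
  simp [Matrix.SpecialLinearGroup.coe_mul, Matrix.SpecialLinearGroup.coe_inv, mul_apply,
    Fin.sum_univ_two, adjugate_fin_two, vecMul, dotProduct, h0, h1] at hz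
  simp only [mulVec, dotProduct, Fin.sum_univ_two]
  linear_combination hz

end
end SLTwo

namespace OrthRep

open Matrix

theorem abs_inner_rho_le {G : Type*} [Group G] {V : Type*} [NormedAddCommGroup V]
    [InnerProductSpace ℝ V] {ρ : Representation ℝ G V} (hρ : IsOrth ρ) (x : G) (f : V) :
    |⟪ρ x f, f⟫_ℝ| ≤ ‖f‖ ^ 2 := by
  refine (abs_real_inner_le_norm _ _).trans ?_
  rw [hρ.norm_eq, sq]

theorem IsTracial.eq_of_isConj {G : Type*} [Group G] {V : Type*} [NormedAddCommGroup V]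
    [InnerProductSpace ℝ V] {ρ : Representation ℝ G V} {f : V} (hf : IsTracial ρ f) {x y : G}
    (h : IsConj x y) : ⟪ρ x f, f⟫_ℝ = ⟪ρ y f, f⟫_ℝ := by
  obtain ⟨c, rfl⟩ := isConj_iff.1 h
  rw [hf.conj]

variable {F V : Type} [Field F] [Fintype F]

theorem smallFixed_upper : SmallFixed (SLTwo.upper : F → _) (2 / Fintype.card F) := by
  intro V _ _ _ ρ hρ hinv
  have h := SLTwo.finrank_fixed_le_of_no_invariants hρ hinv
  have hq : (0 : ℝ) < Fintype.card F := by exact_mod_cast Fintype.card_pos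
  rw [div_mul_eq_mul_div, le_div_iff₀ hq]
  have : (0 : ℝ) ≤ Module.finrank ℝ (fixed ρ (SLTwo.upper : F → _)) := Nat.cast_nonneg _
  linarith

theorem smallFixed_root {ι : Type} [Fintype ι] [DecidableEq ι] (h3 : 3 ≤ Fintype.card ι)
    {v φ : ι → F} (h : φ ⬝ᵥ v = 0) (hv : v ≠ 0) (hφ : φ ≠ 0) :
    SmallFixed (SLN.root v φ h) (6 / Fintype.card F) := by
  intro V _ _ _ ρ hρ hinv
  have h := SLN.finrank_fixed_root_le h3 hρ hinv h hv hφ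
  have hq : (0 : ℝ) < Fintype.card F := by exact_mod_cast Fintype.card_pos
  rw [div_mul_eq_mul_div, le_div_iff₀ hq]
  linarith

variable [NormedAddCommGroup V] [InnerProductSpace ℝ V] [FiniteDimensional ℝ V] {f w : V}

theorem card_mul_sq_inner_le_of_three {ι : Type} [Fintype ι] [DecidableEq ι]
    {ρ : Representation ℝ (SpecialLinearGroup ι F) V}
    (h3 : 3 ≤ Fintype.card ι) (hρ : IsOrth ρ) (hinv : ∀ v, (∀ g, ρ g v = v) → v = 0)
    (hf : IsTracial ρ f) (hw : ∀ g h, ⟪ρ (h * g * h⁻¹) f, w⟫_ℝ = ⟪ρ g f, w⟫_ℝ)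
    {g : SpecialLinearGroup ι F} (hg : g ∉ Subgroup.center (SpecialLinearGroup ι F)) :
    Fintype.card F * ⟪ρ g f, w⟫_ℝ ^ 2 ≤ 12 * ‖f‖ ^ 2 * ‖w‖ ^ 2 := by
  classical
  obtain ⟨v, i, j, hv⟩ := SLN.exists_indep_of_not_mem_center hg
  have hv0 : v ≠ 0 := by rintro rfl; simp at hv
  obtain ⟨φ, hφ0, hφ, -⟩ := SLN.exists_ne_zero_dot_eq_zero h3 v v
  rw [dotProduct_comm] at hφ
  have hq : (0 : ℝ) < Fintype.card F := by exact_mod_cast Fintype.card_pos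
  refine (sq_inner_le hρ hf (SLN.root_add hφ) g w hw).trans
    (mul_le_mul_of_nonneg_right ?_ (sq_nonneg _))
  have hterm : ∀ s, ⟪ρ (g * SLN.root v φ hφ s * g⁻¹ * SLN.root v φ hφ (-s)) f, f⟫_ℝ ≤
      6 / Fintype.card F * ‖f‖ ^ 2 + if s = 0 then ‖f‖ ^ 2 else 0 := fun s => by
    split_ifs with hs
    · have := (abs_le.1 (abs_inner_rho_le hρ
        (g * SLN.root v φ hφ s * g⁻¹ * SLN.root v φ hφ (-s)) f)).2
      have : 0 ≤ 6 / Fintype.card F * ‖f‖ ^ 2 := by positivity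
      linarith
    · obtain ⟨e, θ, hθ, he, hθ0, h⟩ := SLN.exists_conj_commutator h3 g (SLN.smul_dot hφ s)
        (smul_ne_zero hs hφ0) hv
      rw [add_zero, hom_neg (SLN.root_add hφ)]
      exact (inner_rho_le_of_conj hρ hf (SLN.root_add hθ) _ h).trans
        (norm_avg_sq_le hρ (SLN.root_add hθ) (smallFixed_root h3 hθ he hθ0) hinv hf)
  refine (Finset.sum_le_sum fun s _ => hterm s).trans ?_
  rw [Finset.sum_add_distrib, Finset.sum_ite_eq']
  simp only [Finset.sum_const, Finset.card_univ, nsmul_eq_mul, Finset.mem_univ, if_true]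
  have : (Fintype.card F : ℝ) * (6 / Fintype.card F * ‖f‖ ^ 2) = 6 * ‖f‖ ^ 2 := by
    field_simp
  rw [this]
  linarith [sq_nonneg ‖f‖]

section Two

variable {ρ : Representation ℝ (SpecialLinearGroup (Fin 2) F) V}

open SLTwo

omit [FiniteDimensional ℝ V] in
theorem sum_commutator_le (hρ : IsOrth ρ) (hf : IsTracial ρ f)
    {g : SpecialLinearGroup (Fin 2) F} (hg : g.1 1 0 ≠ 0) :
    ∑ a, ⟪ρ (g * upper a * g⁻¹ * upper (-a)) f, f⟫_ℝ ≤
      ∑ b, ⟪ρ (lower 1 * upper (b ^ 2)) f, f⟫_ℝ + 6 * ‖f‖ ^ 2 := by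
  classical
  have hre : ∑ b, ⟪ρ (lower 1 * upper (b ^ 2)) f, f⟫_ℝ =
      ∑ a, ⟪ρ (lower 1 * upper ((g.1 1 0 * a) ^ 2)) f, f⟫_ℝ :=
    (Fintype.sum_equiv (Equiv.mulLeft₀ _ hg) _ _ fun a => rfl).symm
  have hterm : ∀ a, ⟪ρ (g * upper a * g⁻¹ * upper (-a)) f, f⟫_ℝ ≤
      ⟪ρ (lower 1 * upper ((g.1 1 0 * a) ^ 2)) f, f⟫_ℝ +
        if (2 + (g.1 1 0 * a) ^ 2) ^ 2 = 4 then 2 * ‖f‖ ^ 2 else 0 := fun a => by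
    split_ifs with h
    · have h1 := (abs_le.1 (abs_inner_rho_le hρ (g * upper a * g⁻¹ * upper (-a)) f)).2
      have h2 := (abs_le.1 (abs_inner_rho_le hρ (lower 1 * upper ((g.1 1 0 * a) ^ 2)) f)).1
      linarith
    · rw [add_zero, hf.eq_of_isConj
        (isConj_of_trace (trace_commutator g a) (trace_lower_upper _) h)]
  have hcard : (Finset.univ.filter fun a => (2 + (g.1 1 0 * a) ^ 2) ^ 2 = 4).card ≤ 3 := by
    have hroot : ∀ a, (2 + (g.1 1 0 * a) ^ 2) ^ 2 = 4 → a = 0 ∨ (g.1 1 0 * a) ^ 2 = -4 := by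
      intro a ha
      have h0 : (g.1 1 0 * a) ^ 2 * ((g.1 1 0 * a) ^ 2 + 4) = 0 := by linear_combination ha
      rcases mul_eq_zero.1 h0 with h | h
      · exact Or.inl ((mul_eq_zero.1 (pow_eq_zero_iff two_ne_zero |>.1 h)).resolve_left hg)
      · exact Or.inr (eq_neg_of_add_eq_zero_left h)
    by_cases hr : ∃ r, (g.1 1 0 * r) ^ 2 = -4
    · obtain ⟨r, hr⟩ := hr
      refine (Finset.card_le_card (t := {0, r, -r}) fun a ha => ?_).trans Finset.card_le_three
      rcases hroot a (Finset.mem_filter.1 ha).2 with h | h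
      · simp [h]
      · have h2 : a ^ 2 = r ^ 2 := mul_left_cancel₀ (pow_ne_zero 2 hg) (by
          rw [← mul_pow, ← mul_pow, h, hr])
        rcases sq_eq_sq_iff_eq_or_eq_neg.1 h2 with h | h <;> simp [h]
    · refine (Finset.card_le_card (t := {0}) fun a ha => ?_).trans (by simp)
      exact Finset.mem_singleton.2
        ((hroot a (Finset.mem_filter.1 ha).2).resolve_right fun h => hr ⟨a, h⟩)
  rw [hre]
  refine (Finset.sum_le_sum fun a _ => hterm a).trans ?_
  rw [Finset.sum_add_distrib, ← Finset.sum_filter, Finset.sum_const, nsmul_eq_mul]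
  have : ((Finset.univ.filter fun a => (2 + (g.1 1 0 * a) ^ 2) ^ 2 = 4).card : ℝ) ≤ 3 := by
    exact_mod_cast hcard
  nlinarith [sq_nonneg ‖f‖]

omit [FiniteDimensional ℝ V] in
theorem sum_upper (hρ : IsOrth ρ) :
    ∑ a, ⟪ρ (upper a) f, f⟫_ℝ = Fintype.card F * ‖avg ρ (upper : F → _) f‖ ^ 2 := by
  have := card_ne_zero' F
  rw [← inner_avg_self hρ upper_add, avg_apply, inner_smul_left, sum_inner]
  simp

theorem norm_sum_upper_sq_le (hρ : IsOrth ρ) (hinv : ∀ v, (∀ g, ρ g v = v) → v = 0)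
    (hf : IsTracial ρ f) : ‖∑ b, ρ (upper (b ^ 2)) f‖ ^ 2 ≤ 3 * Fintype.card F * ‖f‖ ^ 2 := by
  classical
  have hq : (0 : ℝ) < Fintype.card F := by exact_mod_cast Fintype.card_pos
  have hp := norm_avg_sq_le hρ upper_add smallFixed_upper hinv hf
  have hp' : Fintype.card F * ‖avg ρ (upper : F → _) f‖ ^ 2 ≤ 2 * ‖f‖ ^ 2 := by
    calc _ ≤ Fintype.card F * (2 / Fintype.card F * ‖f‖ ^ 2) :=
          mul_le_mul_of_nonneg_left hp hq.le
      _ = _ := by field_simp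
  by_cases h2 : ringChar F = 2
  · have : CharP F 2 := ringChar.of_eq h2
    have h1 : ∑ b, ρ (upper (b ^ 2)) f = (Fintype.card F : ℝ) • avg ρ (upper : F → _) f := by
      rw [avg_apply, smul_inv_smul₀ hq.ne']
      exact Fintype.sum_bijective (fun b : F => b ^ 2)
        (Finite.injective_iff_bijective.1 (frobenius_inj F 2)) _ _ fun b => rfl
    rw [h1, norm_smul, mul_pow, Real.norm_natCast]
    nlinarith [sq_nonneg ‖f‖]
  have h20 : (2 : F) ≠ 0 := Ring.two_ne_zero h2
  have h1 : ‖∑ b, ρ (upper (b ^ 2)) f‖ ^ 2 =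
      ∑ x : F, ∑ b : F, ⟪ρ (upper (x ^ 2 + 2 * x * b)) f, f⟫_ℝ := by
    rw [← real_inner_self_eq_norm_sq, sum_inner, Finset.sum_comm]
    simp only [inner_sum]
    rw [Finset.sum_comm]
    refine Finset.sum_congr rfl fun b _ => ?_
    refine (Fintype.sum_equiv (Equiv.addRight b) _ _ fun x => ?_).symm
    rw [Equiv.coe_addRight, hρ.inner_right, ← rho_mul_apply, ← hom_neg (upper_add (F := F)),
      ← upper_add]
    congr 4
    ring
  have hterm : ∀ x : F, ∑ b : F, ⟪ρ (upper (x ^ 2 + 2 * x * b)) f, f⟫_ℝ ≤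
      2 * ‖f‖ ^ 2 + if x = 0 then Fintype.card F * ‖f‖ ^ 2 else 0 := fun x => by
    split_ifs with hx
    · subst hx
      have h0 : ∀ b : F, ⟪ρ (upper ((0 : F) ^ 2 + 2 * 0 * b)) f, f⟫_ℝ = ‖f‖ ^ 2 := fun b => by
        rw [show (0 : F) ^ 2 + 2 * 0 * b = 0 by ring, hom_zero (upper_add (F := F)), map_one,
          Module.End.one_apply, real_inner_self_eq_norm_sq]
      simp only [h0, Finset.sum_const, Finset.card_univ, nsmul_eq_mul]
      linarith [sq_nonneg ‖f‖]
    · rw [add_zero]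
      refine le_trans (le_of_eq ?_) hp'
      rw [← sum_upper hρ]
      exact Fintype.sum_equiv ((Equiv.mulLeft₀ (2 * x) (mul_ne_zero h20 hx)).trans
        (Equiv.addLeft (x ^ 2))) _ _ fun b => rfl
  rw [h1]
  refine (Finset.sum_le_sum fun x _ => hterm x).trans ?_
  rw [Finset.sum_add_distrib, Finset.sum_ite_eq']
  simp only [Finset.sum_const, Finset.card_univ, nsmul_eq_mul, Finset.mem_univ, if_true]
  linarith

theorem sum_lower_upper_le (hρ : IsOrth ρ) (hinv : ∀ v, (∀ g, ρ g v = v) → v = 0)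
    (hf : IsTracial ρ f) :
    ∑ b, ⟪ρ (lower 1 * upper (b ^ 2)) f, f⟫_ℝ ≤ 6 * ‖f‖ ^ 2 := by
  set Y := ∑ b, ⟪ρ (lower 1 * upper (b ^ 2)) f, f⟫_ℝ with hY
  have hq : (0 : ℝ) < Fintype.card F := by exact_mod_cast Fintype.card_pos
  have h1 : Fintype.card F * Y = ⟪∑ b, ρ (upper (b ^ 2)) f,
      ∑ c, ρ (upper c * lower (-1) * upper (-c)) f⟫_ℝ := by
    have key : ∀ b c : F, ⟪ρ (upper (b ^ 2)) f, ρ (upper c * lower (-1) * upper (-c)) f⟫_ℝ =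
        ⟪ρ (lower 1 * upper (b ^ 2)) f, f⟫_ℝ := fun b c => by
      rw [hρ.inner_right, ← rho_mul_apply, ← hf.conj (lower 1 * upper (b ^ 2)) (upper c),
        hom_neg (upper_add (F := F)), hom_neg (lower_add (F := F))]
      have : upper c * (lower 1 * upper (b ^ 2)) * (upper c)⁻¹ =
          upper c * lower 1 * (upper c)⁻¹ * upper (b ^ 2) := by
        rw [← hom_neg (upper_add (F := F))]
        simp only [mul_assoc, ← upper_add]
        congr 3
        ring
      rw [this]
      congr 3
      group
    rw [inner_sum]
    simp only [sum_inner, key, ← hY]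
    simp
  have h2 := real_inner_mul_inner_self_le (∑ b, ρ (upper (b ^ 2)) f)
    (∑ c, ρ (upper c * lower (-1) * upper (-c)) f)
  rw [← h1, real_inner_self_eq_norm_sq, real_inner_self_eq_norm_sq,
    norm_sum_conj_sq hρ hf upper_add] at h2
  have h3 := sum_commutator_le hρ hf (g := lower (-1)) (by simp)
  rw [← hY] at h3
  have h4 := norm_sum_upper_sq_le hρ hinv hf
  set S := ∑ c, ⟪ρ (lower (-1) * upper c * (lower (-1))⁻¹ * upper (-c)) f, f⟫_ℝ
  set q : ℝ := ((Fintype.card F : ℕ) : ℝ)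
  by_contra! hlt
  have hf0 := sq_nonneg ‖f‖
  have h5 : q * S ≤ q * (Y + 6 * ‖f‖ ^ 2) := mul_le_mul_of_nonneg_left h3 hq.le
  have h6 : q * Y * (q * Y) ≤ 3 * q * ‖f‖ ^ 2 * (q * (Y + 6 * ‖f‖ ^ 2)) :=
    h2.trans (mul_le_mul_of_nonneg h4 h5 (sq_nonneg _) (mul_nonneg hq.le (by linarith)))
  have h7 : Y * Y ≤ 3 * ‖f‖ ^ 2 * (Y + 6 * ‖f‖ ^ 2) :=
    le_of_mul_le_mul_left (by linarith) (mul_pos hq hq)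
  nlinarith

theorem card_mul_sq_inner_le_of_two (hρ : IsOrth ρ) (hinv : ∀ v, (∀ g, ρ g v = v) → v = 0)
    (hf : IsTracial ρ f) (hw : ∀ g h, ⟪ρ (h * g * h⁻¹) f, w⟫_ℝ = ⟪ρ g f, w⟫_ℝ)
    {g : SpecialLinearGroup (Fin 2) F}
    (hg : g ∉ Subgroup.center (SpecialLinearGroup (Fin 2) F)) :
    Fintype.card F * ⟪ρ g f, w⟫_ℝ ^ 2 ≤ 12 * ‖f‖ ^ 2 * ‖w‖ ^ 2 := by
  obtain ⟨h, hh⟩ := exists_conj_entry_ne_zero hg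
  rw [← hw g h]
  refine (sq_inner_le hρ hf upper_add _ w hw).trans (mul_le_mul_of_nonneg_right ?_ (sq_nonneg _))
  linarith [sum_commutator_le hρ hf hh, sum_lower_upper_le hρ hinv hf]

end Two

end OrthRep

namespace OrthRep

section Regular

theorem inner_eq_sum {G : Type} [Fintype G] (f h : EuclideanSpace ℝ G) :
    ⟪f, h⟫_ℝ = ∑ y, f y * h y := by
  simp [PiLp.inner_apply, mul_comm]

variable {G : Type} [Group G] [Fintype G]

/-- The left regular representation on real functions. -/
noncomputable def regular (G : Type) [Group G] [Fintype G] :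
    Representation ℝ G (EuclideanSpace ℝ G) where
  toFun g :=
    { toFun := fun f => WithLp.toLp 2 fun y => f (g⁻¹ * y)
      map_add' := fun f h => rfl
      map_smul' := fun c f => rfl }
  map_one' := by
    ext f y
    simp
  map_mul' g h := by
    ext f y
    change f ((g * h)⁻¹ * y) = f (h⁻¹ * (g⁻¹ * y))
    rw [_root_.mul_inv_rev, mul_assoc]

theorem isOrth_regular : IsOrth (regular G) := fun g f h => by
  rw [inner_eq_sum, inner_eq_sum]
  exact Fintype.sum_equiv (Equiv.mulLeft g⁻¹) _ _ fun y => rfl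

theorem sq_sum_le_of_class {g : G} {K : ℝ}
    (hg : ∀ (V : Type) [NormedAddCommGroup V] [InnerProductSpace ℝ V] [FiniteDimensional ℝ V]
      (ρ : Representation ℝ G V), IsOrth ρ → (∀ v, (∀ g, ρ g v = v) → v = 0) → ∀ f w,
      IsTracial ρ f → (∀ g h, ⟪ρ (h * g * h⁻¹) f, w⟫_ℝ = ⟪ρ g f, w⟫_ℝ) →
      K * ⟪ρ g f, w⟫_ℝ ^ 2 ≤ 12 * ‖f‖ ^ 2 * ‖w‖ ^ 2)
    {f h : G → ℝ} (hf : ∀ x y, f (y * x * y⁻¹) = f x) (hh : ∀ x y, h (y * x * y⁻¹) = h x)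
    (hf0 : ∑ x, f x = 0) (hh0 : ∑ x, h x = 0) :
    K * (∑ y, f (g⁻¹ * y) * h y) ^ 2 ≤ 12 * (∑ y, f y ^ 2) * ∑ y, h y ^ 2 := by
  set ρ := regular G
  have hmem : ∀ {k : G → ℝ}, ∑ x, k x = 0 → WithLp.toLp 2 k ∈ (fixed ρ id)ᗮ := fun {k} hk => by
    refine (Submodule.mem_orthogonal _ _).2 fun v hv => ?_
    have hv1 : ∀ y, v y = v 1 := fun y => by
      conv_lhs => rw [← hv y]
      exact congrArg v (inv_mul_cancel y)
    rw [inner_eq_sum]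
    simp only [hv1]
    rw [← Finset.mul_sum, hk, mul_zero]
  have hE := invariant_orthogonal (isOrth_regular (G := G)) (invariant_fixed_id (ρ := ρ))
  have hinner : ∀ x, ∀ {k l : G → ℝ}, ⟪ρ x (WithLp.toLp 2 k), WithLp.toLp 2 l⟫_ℝ =
      ∑ y, k (x⁻¹ * y) * l y := fun x k l => inner_eq_sum _ _
  have hconj : ∀ {k : G → ℝ}, (∀ x y, k (y * x * y⁻¹) = k x) → ∀ x y, k (x * y) = k (y * x) :=
    fun hk x y => by rw [← hk (y * x) x]; simp [mul_assoc]
  have := hg _ (ρ.subrepresentation (fixed ρ id)ᗮ hE) (isOrth_regular.sub hE) (fun v hv => by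
      have hv' : (v : EuclideanSpace ℝ G) ∈ fixed ρ id := fun g => congrArg Subtype.val (hv g)
      exact Subtype.ext (inner_self_eq_zero.1 ((Submodule.mem_orthogonal _ _).1 v.2 v hv')))
    ⟨_, hmem hf0⟩ ⟨_, hmem hh0⟩ (fun x y => by
      change ⟪ρ _ (WithLp.toLp 2 f), WithLp.toLp 2 f⟫_ℝ = ⟪ρ _ (WithLp.toLp 2 f), WithLp.toLp 2 f⟫_ℝ
      rw [hinner, hinner]
      refine Fintype.sum_equiv (MulAut.conj y).toEquiv _ _ fun z => ?_
      change _ = f ((y * x)⁻¹ * (y * z * y⁻¹)) * f (y * z * y⁻¹)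
      rw [hf z, _root_.mul_inv_rev, _root_.mul_inv_rev, mul_assoc y⁻¹, hconj hf y⁻¹]
      simp [mul_assoc]) (fun x y => by
      change ⟪ρ _ (WithLp.toLp 2 f), WithLp.toLp 2 h⟫_ℝ = ⟪ρ _ (WithLp.toLp 2 f), WithLp.toLp 2 h⟫_ℝ
      rw [hinner, hinner]
      refine (Fintype.sum_equiv (MulAut.conj y).toEquiv _ _ fun z => ?_).symm
      change _ = f ((y * x * y⁻¹)⁻¹ * (y * z * y⁻¹)) * h (y * z * y⁻¹)
      rw [hh z, ← hf (x⁻¹ * z) y]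
      simp [mul_assoc])
  have hnorm : ∀ k : G → ℝ, ‖WithLp.toLp 2 k‖ ^ 2 = ∑ y, k y ^ 2 := fun k => by
    rw [← real_inner_self_eq_norm_sq, inner_eq_sum]
    simp [sq]
  change K * ⟪ρ g (WithLp.toLp 2 f), WithLp.toLp 2 h⟫_ℝ ^ 2 ≤
    12 * ‖WithLp.toLp 2 f‖ ^ 2 * ‖WithLp.toLp 2 h‖ ^ 2 at this
  rwa [hinner, hnorm, hnorm] at this

theorem exists_mul_eq_of_card {g : G} {K : ℝ} (hK : 0 < K)
    (hg : ∀ (V : Type) [NormedAddCommGroup V] [InnerProductSpace ℝ V] [FiniteDimensional ℝ V]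
      (ρ : Representation ℝ G V), IsOrth ρ → (∀ v, (∀ g, ρ g v = v) → v = 0) → ∀ f w,
      IsTracial ρ f → (∀ g h, ⟪ρ (h * g * h⁻¹) f, w⟫_ℝ = ⟪ρ g f, w⟫_ℝ) →
      K * ⟪ρ g f, w⟫_ℝ ^ 2 ≤ 12 * ‖f‖ ^ 2 * ‖w‖ ^ 2)
    {A B : Finset G} (hA : ∀ x y, y * x * y⁻¹ ∈ A ↔ x ∈ A) (hB : ∀ x y, y * x * y⁻¹ ∈ B ↔ x ∈ B)
    (hAB : 12 * (Fintype.card G : ℝ) ^ 2 < K * (A.card * B.card)) :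
    ∃ a ∈ A, ∃ b ∈ B, a * b = g := by
  classical
  by_contra! hne
  set N : ℝ := ((Fintype.card G : ℕ) : ℝ)
  have hN : 0 < N := Nat.cast_pos.2 Fintype.card_pos
  set a : ℝ := ((A.card : ℕ) : ℝ)
  set b : ℝ := ((B.card : ℕ) : ℝ)
  set iA : G → ℝ := fun y => if y ∈ A then 1 else 0 with hiA
  set iB : G → ℝ := fun y => if y⁻¹ ∈ B then 1 else 0 with hiB
  have sA : ∑ y, iA y = a := by simp [hiA, a]
  have sB : ∑ y, iB y = b := by
    rw [Fintype.sum_equiv (Equiv.inv G) iB (fun y => if y ∈ B then 1 else 0) fun y => rfl]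
    simp [b]
  have sBg : ∑ y, iB (g⁻¹ * y) = b := by
    rw [← sB]
    exact Fintype.sum_equiv (Equiv.mulLeft g⁻¹) _ _ fun y => rfl
  have sAA : ∑ y, iA y ^ 2 = a := by
    rw [← sA]
    exact Finset.sum_congr rfl fun y _ => by simp only [hiA]; split_ifs <;> simp
  have sBB : ∑ y, iB y ^ 2 = b := by
    rw [← sB]
    exact Finset.sum_congr rfl fun y _ => by simp only [hiB]; split_ifs <;> simp
  have sAB : ∑ y, iB (g⁻¹ * y) * iA y = 0 := Finset.sum_eq_zero fun y _ => by
    simp only [hiA, hiB]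
    by_cases hy : y ∈ A
    · have : (g⁻¹ * y)⁻¹ ∉ B := fun h => hne y hy _ h (by simp)
      rw [if_neg this, zero_mul]
    · rw [if_neg hy, mul_zero]
  have h := sq_sum_le_of_class hg (f := fun y => iB y - b / N) (h := fun y => iA y - a / N)
    (fun x y => by
      have := hB x⁻¹ y
      simp only [hiB, _root_.mul_inv_rev, inv_inv, ← mul_assoc, this])
    (fun x y => by simp only [hiA, hA])
    (by rw [Finset.sum_sub_distrib, sB]; simp [N]; field_simp; ring)
    (by rw [Finset.sum_sub_distrib, sA]; simp [N]; field_simp; ring)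
  have e1 : ∑ y, (iB (g⁻¹ * y) - b / N) * (iA y - a / N) = -(a * b / N) := by
    simp only [sub_mul, mul_sub, Finset.sum_sub_distrib, ← Finset.sum_mul, ← Finset.mul_sum, sAB,
      sA, sBg]
    simp [N]
    field_simp
    ring
  have e2 : ∑ y, (iB y - b / N) ^ 2 ≤ b := by
    have : ∑ y, (iB y - b / N) ^ 2 = b - b ^ 2 / N := by
      simp only [sub_sq, Finset.sum_sub_distrib, Finset.sum_add_distrib, ← Finset.sum_mul,
        ← Finset.mul_sum, sBB, sB]
      simp [N]
      field_simp
      ring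
    rw [this]
    have : 0 ≤ b ^ 2 / N := by positivity
    linarith
  have e3 : ∑ y, (iA y - a / N) ^ 2 ≤ a := by
    have : ∑ y, (iA y - a / N) ^ 2 = a - a ^ 2 / N := by
      simp only [sub_sq, Finset.sum_sub_distrib, Finset.sum_add_distrib, ← Finset.sum_mul,
        ← Finset.mul_sum, sAA, sA]
      simp [N]
      field_simp
      ring
    rw [this]
    have : 0 ≤ a ^ 2 / N := by positivity
    linarith
  rw [e1] at h
  have e4 := mul_le_mul e2 e3 (Finset.sum_nonneg fun _ _ => sq_nonneg _)
    (Nat.cast_nonneg _ : 0 ≤ b)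
  have e5 : K * (-(a * b / N)) ^ 2 ≤ 12 * (a * b) := by linarith
  have hab : 0 < a * b := by
    by_contra! h0
    have := mul_nonpos_of_nonneg_of_nonpos hK.le h0
    have : 0 < N ^ 2 := by positivity
    linarith
  have e6 : K * (-(a * b / N)) ^ 2 = (K * (a * b)) * (a * b) / N ^ 2 := by ring
  rw [e6, div_le_iff₀ (by positivity)] at e5
  have := mul_lt_mul_of_pos_right hAB hab
  linarith

end Regular

theorem ncard_preimage_mk {G : Type*} [Group G] (Z : Subgroup G) (A : Set (G ⧸ Z)) :
    ((QuotientGroup.mk ⁻¹' A : Set G)).ncard = Nat.card Z * A.ncard := by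
  rw [← Nat.card_coe_set_eq, Nat.card_congr (QuotientGroup.preimageMkEquivSubgroupProdSet Z A),
    Nat.card_prod, Nat.card_coe_set_eq]

theorem mk_mem_mul_of_card {G : Type} [Group G] [Fintype G] {Z : Subgroup G} [Z.Normal] {g : G}
    {K : ℝ} (hK : 0 < K)
    (hg : ∀ (V : Type) [NormedAddCommGroup V] [InnerProductSpace ℝ V] [FiniteDimensional ℝ V]
      (ρ : Representation ℝ G V), IsOrth ρ → (∀ v, (∀ g, ρ g v = v) → v = 0) → ∀ f w,
      IsTracial ρ f → (∀ g h, ⟪ρ (h * g * h⁻¹) f, w⟫_ℝ = ⟪ρ g f, w⟫_ℝ) →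
      K * ⟪ρ g f, w⟫_ℝ ^ 2 ≤ 12 * ‖f‖ ^ 2 * ‖w‖ ^ 2)
    {A B : Set (G ⧸ Z)} (hA : ∀ a ∈ A, ∀ g, g * a * g⁻¹ ∈ A) (hB : ∀ b ∈ B, ∀ g, g * b * g⁻¹ ∈ B)
    (hAB : 13 / K * (Nat.card (G ⧸ Z) : ℝ) ^ 2 ≤ (A.ncard : ℝ) * B.ncard) :
    (g : G ⧸ Z) ∈ A * B := by
  classical
  have hnormal : ∀ {S : Set (G ⧸ Z)}, (∀ a ∈ S, ∀ g, g * a * g⁻¹ ∈ S) → ∀ x y : G,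
      y * x * y⁻¹ ∈ (QuotientGroup.mk ⁻¹' S : Set G).toFinset ↔
        x ∈ (QuotientGroup.mk ⁻¹' S : Set G).toFinset := by
    intro S hS x y
    rw [Set.mem_toFinset, Set.mem_toFinset]
    refine ⟨fun h => ?_, fun h => hS _ h y⟩
    have := hS _ h (y⁻¹ : G)
    rw [← QuotientGroup.mk_inv, ← QuotientGroup.mk_mul, ← QuotientGroup.mk_mul] at this
    simpa [mul_assoc] using this
  have hcard : ∀ S : Set (G ⧸ Z), ((QuotientGroup.mk ⁻¹' S : Set G).toFinset.card : ℝ) =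
      Nat.card Z * S.ncard := fun S => by
    rw [← Set.ncard_eq_toFinset_card', ncard_preimage_mk, Nat.cast_mul]
  have hZ0 : (0 : ℝ) < Nat.card Z := Nat.cast_pos.2 Nat.card_pos
  have hP0 : (0 : ℝ) < Nat.card (G ⧸ Z) := Nat.cast_pos.2 Nat.card_pos
  obtain ⟨a, ha, b, hb, rfl⟩ := exists_mul_eq_of_card hK hg (hnormal hA) (hnormal hB) (by
    rw [hcard, hcard, ← Nat.card_eq_fintype_card,
      Subgroup.card_eq_card_quotient_mul_card_subgroup Z, Nat.cast_mul]
    rw [div_mul_eq_mul_div, div_le_iff₀ hK] at hAB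
    have h1 := mul_le_mul_of_nonneg_right hAB (sq_nonneg (Nat.card Z : ℝ))
    have h2 := mul_pos (pow_pos hP0 2) (pow_pos hZ0 2)
    linarith)
  rw [Set.mem_toFinset] at ha hb
  exact ⟨a, ha, b, hb, rfl⟩

end OrthRep

theorem stmt9 :
    ∃ C : ℝ, 0 < C ∧
      ∀ (n q : ℕ), 2 ≤ n → IsPrimePow q → ¬(n = 2 ∧ (q = 2 ∨ q = 3)) →
      ∀ (F : Type) [Field F] [Fintype F], Fintype.card F = q →
      ∀ (A B : Set (Matrix.ProjectiveSpecialLinearGroup (Fin n) F)),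
        (∀ a ∈ A, ∀ g, g * a * g⁻¹ ∈ A) →
        (∀ b ∈ B, ∀ g, g * b * g⁻¹ ∈ B) →
        (A.ncard : ℝ) * (B.ncard : ℝ) ≥
          C / (q : ℝ) *
            (Nat.card (Matrix.ProjectiveSpecialLinearGroup (Fin n) F) : ℝ) ^ 2 →
        ∀ g : Matrix.ProjectiveSpecialLinearGroup (Fin n) F, g ≠ 1 → g ∈ A * B := by
  classical
  refine ⟨13, by norm_num, ?_⟩
  intro n q hn _ _ F _ _ hq A B hA hB hAB g hg
  obtain ⟨x, rfl⟩ := QuotientGroup.mk_surjective g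
  have hx : x ∉ Subgroup.center (Matrix.SpecialLinearGroup (Fin n) F) :=
    fun h => hg ((QuotientGroup.eq_one_iff x).2 h)
  have hq0 : (0 : ℝ) < q := by
    rw [← hq]
    exact Nat.cast_pos.2 Fintype.card_pos
  refine OrthRep.mk_mem_mul_of_card hq0 ?_ hA hB hAB
  intro V _ _ _ ρ hρ hinv f w hf hw
  rw [← hq]
  rcases hn.eq_or_lt with rfl | h3
  · exact OrthRep.card_mul_sq_inner_le_of_two hρ hinv hf hw hx
  · exact OrthRep.card_mul_sq_inner_le_of_three (by rw [Fintype.card_fin]; exact h3)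
      hρ hinv hf hw hx
end

section
/- There exists N such that for every prime p > N the following holds for G = PSL₂(𝔽_p): if A is a normal subset of G with A⁻¹ = A and |A| > |G|/log₂|G|, then A² = G. -/
open scoped Pointwise
open Matrix

section FiniteField

variable {F : Type*} [Field F]

/-- The companion matrix of `X ^ 2 - t * X + 1`, as an element of `SL(2, F)`. -/
def companionSL (t : F) : Matrix.SpecialLinearGroup (Fin 2) F :=
  ⟨!![0, -1; 1, t], by simp [det_fin_two]⟩

/-- The matrix of `M` in the basis `v, M v` is the companion matrix. -/
theorem mul_eq_mul_companionSL (M : Matrix.SpecialLinearGroup (Fin 2) F) (x y : F) :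
    M.1 * !![x, M 0 0 * x + M 0 1 * y; y, M 1 0 * x + M 1 1 * y] =
      !![x, M 0 0 * x + M 0 1 * y; y, M 1 0 * x + M 1 1 * y] * (companionSL M.1.trace).1 := by
  have hdet := M.2
  rw [det_fin_two] at hdet
  ext i j
  fin_cases i <;> fin_cases j <;> simp [companionSL, Matrix.mul_apply, trace_fin_two]
  · linear_combination (-x) * hdet
  · linear_combination (-y) * hdet

theorem card_specialLinearGroup_le_two_mul :
    Nat.card (Matrix.SpecialLinearGroup (Fin 2) F) ≤
      2 * Nat.card (Matrix.ProjectiveSpecialLinearGroup (Fin 2) F) := by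
  rw [Subgroup.card_eq_card_quotient_mul_card_subgroup
    (Subgroup.center (Matrix.SpecialLinearGroup (Fin 2) F)), mul_comm]
  refine Nat.mul_le_mul_right _ ?_
  rw [Nat.card_congr (Matrix.SpecialLinearGroup.center_equiv_rootsOfUnity' (0 : Fin 2)).toEquiv]
  exact card_rootsOfUnity F 2

variable [Fintype F]

theorem exists_root_sq_add_quadratic (hF : ringChar F ≠ 2) {u : F} (hu : u ≠ 0) (s v w : F) :
    ∃ a b : F, a ^ 2 + s * a + (u * b ^ 2 + v * b + w) = 0 := by
  obtain ⟨a, b, h⟩ := FiniteField.exists_root_sum_quadratic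
    (Polynomial.degree_quadratic (b := s) (c := 0) (one_ne_zero : (1 : F) ≠ 0))
    (Polynomial.degree_quadratic (b := v) (c := w) hu)
    (FiniteField.odd_card_of_char_ne_two hF)
  refine ⟨a, b, ?_⟩
  simpa using h

theorem exists_binary_form_eq_one (hF : ringChar F ≠ 2) {a b c : F}
    (h : b ^ 2 - 4 * a * c ≠ 0) : ∃ x y : F, a * x ^ 2 + b * x * y + c * y ^ 2 = 1 := by
  have h2 : (2 : F) ≠ 0 := Ring.two_ne_zero hF
  by_cases ha : a = 0
  · subst ha
    have hb : b ≠ 0 := by rintro rfl; simp at h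
    refine ⟨(1 - c) / b, 1, ?_⟩
    field_simp
    ring
  · have hu : -(b ^ 2 - 4 * a * c) / (2 * a) ^ 2 ≠ 0 := by
      have := neg_ne_zero.mpr h
      positivity
    obtain ⟨x, y, hxy⟩ := exists_root_sq_add_quadratic hF hu 0 0 (-1 / a)
    refine ⟨x - b / (2 * a) * y, y, ?_⟩
    field_simp at hxy ⊢
    linear_combination hxy

theorem exists_trace_conic_point (hF : ringChar F ≠ 2) {x y : F} (z : F) (h : y ^ 2 ≠ x ^ 2) :
    ∃ a c : F, a * (x - a) - (c + a * z - y) * c = 1 := by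
  have h2 : (2 : F) ≠ 0 := Ring.two_ne_zero hF
  by_cases hz : z ^ 2 = 4
  · have hk : x * z - 2 * y ≠ 0 := fun hk => h <| by
      refine mul_left_cancel₀ (mul_ne_zero h2 h2) ?_
      linear_combination (-(x * z) - 2 * y) * hk + x ^ 2 * hz
    have hk' := mul_inv_cancel₀ hk
    set k := (x * z - 2 * y)⁻¹
    exact ⟨z * k, -2 * k, by linear_combination hk' + k ^ 2 * hz⟩
  · obtain ⟨a, b, hab⟩ := exists_root_sq_add_quadratic hF
      (sub_ne_zero.mpr (Ne.symm hz)) (-x) (x * z - 2 * y) 1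
    exact ⟨a - z * b, 2 * b, by linear_combination -hab⟩

theorem isConj_companionSL (hF : ringChar F ≠ 2) {M : Matrix.SpecialLinearGroup (Fin 2) F}
    (hM : M.1.trace ^ 2 ≠ 4) : IsConj (companionSL M.1.trace) M := by
  have hdet := M.2
  rw [det_fin_two] at hdet
  rw [trace_fin_two] at hM
  obtain ⟨x, y, hxy⟩ := exists_binary_form_eq_one hF
    (a := M 1 0) (b := M 1 1 - M 0 0) (c := -M 0 1) (fun h0 => hM <| by
      linear_combination h0 + 4 * hdet)
  let P : Matrix.SpecialLinearGroup (Fin 2) F :=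
    ⟨!![x, M 0 0 * x + M 0 1 * y; y, M 1 0 * x + M 1 1 * y], by
      rw [det_fin_two_of]; linear_combination hxy⟩
  exact isConj_iff.mpr ⟨P, mul_inv_eq_iff_eq_mul.mpr <|
    Subtype.ext (mul_eq_mul_companionSL M x y).symm⟩

theorem isConj_of_trace_eq (hF : ringChar F ≠ 2) {M N : Matrix.SpecialLinearGroup (Fin 2) F}
    (h : M.1.trace = N.1.trace) (hM : M.1.trace ^ 2 ≠ 4) : IsConj M N := by
  have hM' := isConj_companionSL hF hM
  rw [h] at hM hM'
  exact hM'.symm.trans (isConj_companionSL hF hM)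

theorem exists_mul_eq_of_trace (hF : ringChar F ≠ 2) {x y : F} (h : y ^ 2 ≠ x ^ 2)
    (g : Matrix.SpecialLinearGroup (Fin 2) F)
    (hg : g ∉ Subgroup.center (Matrix.SpecialLinearGroup (Fin 2) F)) :
    ∃ m n : Matrix.SpecialLinearGroup (Fin 2) F, m.1.trace = x ∧ n.1.trace = y ∧ m * n = g := by
  have hdet := g.2
  rw [det_fin_two] at hdet
  obtain ⟨r, s, hk⟩ : ∃ r s : F,
      r * (g 1 0 * r + g 1 1 * s) - (g 0 0 * r + g 0 1 * s) * s ≠ 0 := by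
    by_contra! hall
    have h10 : g 1 0 = 0 := by simpa using hall 1 0
    have h01 : g 0 1 = 0 := by simpa using hall 0 1
    have h11 : g 1 1 = g 0 0 := by simpa [h10, h01, sub_eq_zero] using hall 1 1
    refine hg (Matrix.SpecialLinearGroup.mem_center_iff.mpr ⟨g 0 0, ?_, ?_⟩)
    · simp only [Fintype.card_fin]
      linear_combination hdet - g 0 0 * h11 + g 1 0 * h01
    · ext i j
      fin_cases i <;> fin_cases j <;> simp [h10, h01, h11]
  obtain ⟨a, c, hac⟩ := exists_trace_conic_point hF g.1.trace h
  let P : Matrix (Fin 2) (Fin 2) F :=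
    !![r, g 0 0 * r + g 0 1 * s; s, g 1 0 * r + g 1 1 * s]
  have hP : IsUnit P.det := by
    rw [isUnit_iff_ne_zero, det_fin_two_of]; exact hk
  let m : Matrix (Fin 2) (Fin 2) F := !![a, c + a * g.1.trace - y; c, x - a]
  have hm : m.det = 1 := by rw [det_fin_two_of]; exact hac
  let C : Matrix (Fin 2) (Fin 2) F := (companionSL g.1.trace).1
  have hgP : g.1 * P = P * C := mul_eq_mul_companionSL g r s
  have hPu : IsUnit P := (isUnit_iff_isUnit_det P).mpr hP
  have hPC : P * C * P⁻¹ = g.1 := by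
    rw [← hgP, mul_nonsing_inv_cancel_right _ _ hP]
  let m' : Matrix.SpecialLinearGroup (Fin 2) F := ⟨P * m * P⁻¹, by rw [det_conj hPu, hm]⟩
  have hmul : m'.1 * (P * (m.adjugate * C) * P⁻¹) = g.1 := by
    calc P * m * P⁻¹ * (P * (m.adjugate * C) * P⁻¹)
        = P * m * (P⁻¹ * P) * (m.adjugate * C) * P⁻¹ := by simp only [Matrix.mul_assoc]
      _ = P * (m * m.adjugate) * C * P⁻¹ := by
        rw [nonsing_inv_mul _ hP]; simp only [Matrix.mul_assoc, Matrix.one_mul]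
      _ = g.1 := by rw [mul_adjugate, hm, one_smul, Matrix.mul_one, hPC]
  refine ⟨m', ⟨P * (m.adjugate * C) * P⁻¹, ?_⟩, ?_, ?_, Subtype.ext hmul⟩
  · have := congrArg det hmul
    rwa [det_mul, m'.2, g.2, one_mul] at this
  · change (P * m * P⁻¹).trace = x
    rw [trace_conj hPu, trace_fin_two_of]
    ring
  · change (P * (m.adjugate * C) * P⁻¹).trace = y
    rw [trace_conj hPu]
    change (m.adjugate * !![0, -1; 1, g.1.trace]).trace = y
    rw [adjugate_fin_two_of, mul_fin_two, trace_fin_two_of]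
    ring

theorem ncard_trace_eq_le (t : F) :
    {M : Matrix.SpecialLinearGroup (Fin 2) F | M.1.trace = t}.ncard ≤ 2 * Nat.card F ^ 2 := by
  classical
  have h : Nat.card {M : Matrix.SpecialLinearGroup (Fin 2) F | M.1.trace = t} ≤
      Nat.card (F × F ⊕ F × F) := by
    refine Nat.card_le_card_of_injective
      (fun M => if M.1 0 1 = 0 then .inl (M.1 0 0, M.1 1 0) else .inr (M.1 0 0, M.1 0 1)) ?_
    rintro ⟨M, hM⟩ ⟨N, hN⟩ hMN
    rw [Set.mem_ofPred_eq, trace_fin_two] at hM hN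
    have hdM := M.2
    have hdN := N.2
    rw [det_fin_two] at hdM hdN
    have key : M 0 0 = N 0 0 ∧ M 0 1 = N 0 1 ∧ M 1 0 = N 1 0 := by
      by_cases h1 : M 0 1 = 0 <;> by_cases h2 : N 0 1 = 0 <;> simp [h1, h2] at hMN
      · exact ⟨hMN.1, h1.trans h2.symm, hMN.2⟩
      · refine ⟨hMN.1, hMN.2, mul_left_cancel₀ h2 ?_⟩
        rw [hMN.2] at hdM
        linear_combination hdN - hdM + M 0 0 * hM - N 0 0 * hN -
          (M 0 0 + N 0 0 - t) * hMN.1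
    obtain ⟨h00, h01, h10⟩ := key
    have h11 : M 1 1 = N 1 1 := by linear_combination hM - hN - h00
    refine Subtype.ext (Subtype.ext ?_)
    ext i j
    fin_cases i <;> fin_cases j <;> assumption
  rw [Nat.card_sum, Nat.card_prod] at h
  rw [← Nat.card_coe_set_eq]
  linarith

theorem ncard_sq_trace_eq_le (t : F) :
    {M : Matrix.SpecialLinearGroup (Fin 2) F | M.1.trace ^ 2 = t ^ 2}.ncard ≤
      4 * Nat.card F ^ 2 := by
  have h : {M : Matrix.SpecialLinearGroup (Fin 2) F | M.1.trace ^ 2 = t ^ 2} =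
      {M | M.1.trace = t} ∪ {M | M.1.trace = -t} := by
    ext M
    exact sq_eq_sq_iff_eq_or_eq_neg
  rw [h]
  linarith [Set.ncard_union_le {M : Matrix.SpecialLinearGroup (Fin 2) F | M.1.trace = t}
    {M | M.1.trace = -t}, ncard_trace_eq_le t, ncard_trace_eq_le (-t)]

theorem le_card_specialLinearGroup :
    (Nat.card F - 1) * Nat.card F ^ 2 ≤ Nat.card (Matrix.SpecialLinearGroup (Fin 2) F) := by
  have h : Nat.card (Fˣ × F × F) ≤ Nat.card (Matrix.SpecialLinearGroup (Fin 2) F) := by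
    refine Nat.card_le_card_of_injective (fun v => ⟨!![(v.1 : F), v.2.1; v.2.2,
      (1 + v.2.1 * v.2.2) / v.1], by rw [det_fin_two_of]; field_simp; ring⟩) ?_
    rintro ⟨a, b, c⟩ ⟨a', b', c'⟩ h
    have h := congrArg Subtype.val h
    have h00 := congrFun (congrFun h 0) 0
    have h01 := congrFun (congrFun h 0) 1
    have h10 := congrFun (congrFun h 1) 0
    simp only [of_apply, cons_val', cons_val_zero, cons_val_one, cons_val_fin_one] at h00 h01 h10
    rw [Units.ext h00, h01, h10]
  rw [Nat.card_prod, Nat.card_prod, Nat.card_units] at h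
  linarith

theorem card_specialLinearGroup_le :
    Nat.card (Matrix.SpecialLinearGroup (Fin 2) F) ≤ Nat.card F ^ 4 := by
  refine (Nat.card_le_card_of_injective Subtype.val Subtype.val_injective).trans_eq ?_
  change Nat.card (Fin 2 → Fin 2 → F) = _
  simp only [Nat.card_fun, Nat.card_fin]
  ring

theorem mul_self_eq_univ_of_normal (hF : ringChar F ≠ 2)
    {A : Set (Matrix.ProjectiveSpecialLinearGroup (Fin 2) F)}
    (hA : ∀ a ∈ A, ∀ g, g * a * g⁻¹ ∈ A) (hinv : A⁻¹ = A)
    (hcard : 8 * Nat.card F ^ 2 < A.ncard) : A * A = Set.univ := by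
  let π := QuotientGroup.mk' (Subgroup.center (Matrix.SpecialLinearGroup (Fin 2) F))
  have hle : A.ncard ≤ (π ⁻¹' A).ncard := by
    conv_lhs => rw [← Set.image_preimage_eq A (QuotientGroup.mk'_surjective _ : Function.Surjective π)]
    exact Set.ncard_image_le (Set.toFinite _)
  have avoid (x : F) : ∃ M : Matrix.SpecialLinearGroup (Fin 2) F,
      π M ∈ A ∧ M.1.trace ^ 2 ≠ 4 ∧ M.1.trace ^ 2 ≠ x ^ 2 := by
    by_contra! hall
    have hsub : π ⁻¹' A ⊆ {M | M.1.trace ^ 2 = 2 ^ 2} ∪ {M | M.1.trace ^ 2 = x ^ 2} := by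
      intro M hM
      by_cases h4 : M.1.trace ^ 2 = 4
      · left
        rw [Set.mem_ofPred_eq, h4]
        norm_num
      · exact .inr (hall M hM h4)
    linarith [Set.ncard_le_ncard hsub (Set.toFinite _), ncard_sq_trace_eq_le (2 : F),
      ncard_sq_trace_eq_le x, Set.ncard_union_le
        {M : Matrix.SpecialLinearGroup (Fin 2) F | M.1.trace ^ 2 = 2 ^ 2}
        {M | M.1.trace ^ 2 = x ^ 2}]
  have mem {M N : Matrix.SpecialLinearGroup (Fin 2) F} (hM : π M ∈ A)
      (h4 : M.1.trace ^ 2 ≠ 4) (h : M.1.trace = N.1.trace) : π N ∈ A := by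
    obtain ⟨g, rfl⟩ := isConj_iff.mp (isConj_of_trace_eq hF h h4)
    simpa using hA _ hM (π g)
  obtain ⟨M, hM, hM4, -⟩ := avoid 0
  obtain ⟨N, hN, hN4, hNM⟩ := avoid M.1.trace
  refine Set.eq_univ_of_forall fun g => ?_
  obtain ⟨g, rfl⟩ : ∃ g', π g' = g := QuotientGroup.mk'_surjective _ g
  by_cases hg : g ∈ Subgroup.center (Matrix.SpecialLinearGroup (Fin 2) F)
  · refine Set.mem_mul.mpr ⟨π M, hM, (π M)⁻¹, ?_, ?_⟩
    · rwa [← hinv, Set.inv_mem_inv]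
    · rw [mul_inv_cancel]
      exact ((QuotientGroup.eq_one_iff g).mpr hg).symm
  · obtain ⟨m, n, hm, hn, rfl⟩ := exists_mul_eq_of_trace hF hNM g hg
    rw [map_mul]
    exact Set.mul_mem_mul (mem hM hM4 hm.symm) (mem hN hN4 hn.symm)

end FiniteField

theorem eventually_logb_le_sub_one :
    ∀ᶠ n : ℕ in Filter.atTop, 64 * Real.logb 2 n ≤ n - 1 := by
  have hlog2 : 0 < Real.log 2 := Real.log_pos one_lt_two
  have h := (Real.isLittleO_log_id_atTop.comp_tendsto tendsto_natCast_atTop_atTop).bound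
    (show (0 : ℝ) < Real.log 2 / 128 by positivity)
  filter_upwards [h, Filter.eventually_ge_atTop 2] with n hn hn2
  have hn2' : (2 : ℝ) ≤ n := by exact_mod_cast hn2
  have hn' : Real.log n ≤ Real.log 2 / 128 * n := by
    simpa [abs_of_nonneg (Real.log_natCast_nonneg n)] using hn
  have : Real.logb 2 n ≤ n / 128 := by
    rw [Real.logb, div_le_iff₀ hlog2]
    linarith
  linarith

theorem stmt10 :
    ∃ N : ℕ, ∀ p : ℕ, p.Prime → N < p →
      ∀ A : Set (Matrix.ProjectiveSpecialLinearGroup (Fin 2) (ZMod p)),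
        (∀ a ∈ A, ∀ g, g * a * g⁻¹ ∈ A) →
        A⁻¹ = A →
        (Nat.card (Matrix.ProjectiveSpecialLinearGroup (Fin 2) (ZMod p)) : ℝ) /
            Real.logb 2
              (Nat.card (Matrix.ProjectiveSpecialLinearGroup (Fin 2) (ZMod p)) : ℝ) <
          (A.ncard : ℝ) →
        A * A = Set.univ := by
  obtain ⟨N, hN⟩ := Filter.eventually_atTop.mp eventually_logb_le_sub_one
  refine ⟨max N 2, fun p hp hNp A hA hinv hcard => ?_⟩
  have : Fact p.Prime := ⟨hp⟩
  have hp2 : 2 < p := (le_max_right N 2).trans_lt hNp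
  have hlog := hN p ((le_max_left N 2).trans hNp.le)
  refine mul_self_eq_univ_of_normal (by rw [ZMod.ringChar_zmod_n]; exact hp2.ne') hA hinv ?_
  have hlow := (le_card_specialLinearGroup (F := ZMod p)).trans card_specialLinearGroup_le_two_mul
  have hup : Nat.card (Matrix.ProjectiveSpecialLinearGroup (Fin 2) (ZMod p)) ≤ p ^ 4 := by
    refine (Nat.card_le_card_of_surjective _ (QuotientGroup.mk'_surjective _)).trans ?_
    simpa using card_specialLinearGroup_le (F := ZMod p)
  generalize Nat.card (Matrix.ProjectiveSpecialLinearGroup (Fin 2) (ZMod p)) = n at *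
  rw [Nat.card_zmod] at hlow ⊢
  have hlow' : ((p : ℝ) - 1) * p ^ 2 ≤ 2 * n := by
    have := (Nat.cast_le (α := ℝ)).mpr hlow
    rwa [Nat.cast_mul, Nat.cast_mul, Nat.cast_pow, Nat.cast_pred hp.pos, Nat.cast_ofNat] at this
  have hp2' : (2 : ℝ) < p := by exact_mod_cast hp2
  have hn1 : (1 : ℝ) < n := by nlinarith
  have hlogn : Real.logb 2 n ≤ 4 * Real.logb 2 p := by
    rw [← Nat.cast_ofNat (n := 4), ← Real.logb_pow]
    exact Real.logb_le_logb_of_le one_lt_two (by linarith) (by exact_mod_cast hup)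
  have hpos : 0 < Real.logb 2 n := Real.logb_pos one_lt_two hn1
  rw [div_lt_iff₀ hpos] at hcard
  have hq : 8 * (p : ℝ) ^ 2 * Real.logb 2 n ≤ n := by
    have := mul_le_mul_of_nonneg_left (show 16 * Real.logb 2 n ≤ p - 1 by linarith)
      (sq_nonneg (p : ℝ))
    linarith
  exact_mod_cast lt_of_mul_lt_mul_right (hq.trans_lt hcard) hpos.le
end
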